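/- Assume k₁/ρ₁ = k₂/ρ₂ and k₁ = k₃ (equal wave speeds). Then there exist NO data as in the resolvent-sequence setting with ℓ = 0: it is impossible to have a sequence (λₙ) of nonzero reals with |λₙ| → ∞ together with tuples Uₙ, Fₙ satisfying all the regularity assumptions, boundary conditions and resolvent equations of the setting with ℓ = 0, ‖Uₙ‖_H = 1 for all n, and ‖Fₙ‖_H → 0. (This is the frequency-domain criterion underlying the exponential stability of the Bresse semigroup when the three waves have the same speed of propagation: the resolvent (iλ − 𝒜)⁻¹ is uniformly bounded on the imaginary axis.) -/

import Mathlib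

open Set Filter MeasureTheory

noncomputable section

/-- The resolvent-sequence setting for the locally damped Bresse system with
parameter `ℓ`: a sequence of nonzero frequencies `lam n` with `|lam n| → ∞`,
solutions `Uₙ = (v1,…,v6)` and right-hand sides `Fₙ = (f1,…,f6)` of the resolvent
equations `(lam n)^ℓ (i (lam n) I − 𝒜) Uₙ = Fₙ`, with `‖Uₙ‖_H = 1` and `‖Fₙ‖_H → 0`. -/
structure BresseSetting (ρ₁ ρ₂ k₁ k₂ k₃ l L β a₀ : ℝ) (ℓ : ℕ) where
  lam : ℕ → ℝ
  v1 : ℕ → ℝ → ℂ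
  v2 : ℕ → ℝ → ℂ
  v3 : ℕ → ℝ → ℂ
  v4 : ℕ → ℝ → ℂ
  v5 : ℕ → ℝ → ℂ
  v6 : ℕ → ℝ → ℂ
  f1 : ℕ → ℝ → ℂ
  f2 : ℕ → ℝ → ℂ
  f3 : ℕ → ℝ → ℂ
  f4 : ℕ → ℝ → ℂ
  f5 : ℕ → ℝ → ℂ
  f6 : ℕ → ℝ → ℂ
  lam_ne : ∀ n, lam n ≠ 0
  lam_tendsto : Tendsto (fun n => |lam n|) atTop atTop
  reg_v1 : ∀ n, ContDiffOn ℝ 2 (v1 n) (Icc 0 L)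
  reg_v3 : ∀ n, ContDiffOn ℝ 2 (v3 n) (Icc 0 L)
  reg_v5 : ∀ n, ContDiffOn ℝ 1 (v5 n) (Icc 0 L)
  reg_v5_left : ∀ n, ContDiffOn ℝ 2 (v5 n) (Icc 0 β)
  reg_v5_right : ∀ n, ContDiffOn ℝ 2 (v5 n) (Icc β L)
  reg_v2 : ∀ n, ContDiffOn ℝ 1 (v2 n) (Icc 0 L)
  reg_v4 : ∀ n, ContDiffOn ℝ 1 (v4 n) (Icc 0 L)
  reg_v6 : ∀ n, ContDiffOn ℝ 1 (v6 n) (Icc 0 L)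
  reg_f1 : ∀ n, ContDiffOn ℝ 1 (f1 n) (Icc 0 L)
  reg_f3 : ∀ n, ContDiffOn ℝ 1 (f3 n) (Icc 0 L)
  reg_f5 : ∀ n, ContDiffOn ℝ 1 (f5 n) (Icc 0 L)
  reg_f2 : ∀ n, ContinuousOn (f2 n) (Icc 0 L)
  reg_f4 : ∀ n, ContinuousOn (f4 n) (Icc 0 L)
  reg_f6 : ∀ n, ContinuousOn (f6 n) (Icc 0 L)
  bc_zero : ∀ n, v1 n 0 = 0 ∧ v2 n 0 = 0 ∧ v3 n 0 = 0 ∧ v4 n 0 = 0 ∧ v5 n 0 = 0 ∧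
      v6 n 0 = 0 ∧ f1 n 0 = 0 ∧ f3 n 0 = 0 ∧ f5 n 0 = 0
  bc_L : ∀ n, v1 n L = 0 ∧ v2 n L = 0 ∧ v3 n L = 0 ∧ v4 n L = 0 ∧ v5 n L = 0 ∧
      v6 n L = 0 ∧ f1 n L = 0 ∧ f3 n L = 0 ∧ f5 n L = 0
  eq1 : ∀ n, ∀ x ∈ Ioo (0 : ℝ) β ∪ Ioo β L,
      Complex.I * (lam n : ℂ) * v1 n x - v2 n x = (lam n : ℂ) ^ (-(ℓ : ℤ)) * f1 n x
  eq2 : ∀ n, ∀ x ∈ Ioo (0 : ℝ) β ∪ Ioo β L,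
      Complex.I * (lam n : ℂ) * (ρ₁ : ℂ) * v2 n x
        - (k₁ : ℂ) * deriv (fun y => deriv (v1 n) y + v3 n y + (l : ℂ) * v5 n y) x
        - (l : ℂ) * (k₃ : ℂ) * (deriv (v5 n) x - (l : ℂ) * v1 n x)
        = (ρ₁ : ℂ) * (lam n : ℂ) ^ (-(ℓ : ℤ)) * f2 n x
  eq3 : ∀ n, ∀ x ∈ Ioo (0 : ℝ) β ∪ Ioo β L,
      Complex.I * (lam n : ℂ) * v3 n x - v4 n x = (lam n : ℂ) ^ (-(ℓ : ℤ)) * f3 n x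
  eq4 : ∀ n, ∀ x ∈ Ioo (0 : ℝ) β ∪ Ioo β L,
      Complex.I * (lam n : ℂ) * (ρ₂ : ℂ) * v4 n x
        - (k₂ : ℂ) * deriv (deriv (v3 n)) x
        + (k₁ : ℂ) * (deriv (v1 n) x + v3 n x + (l : ℂ) * v5 n x)
        = (ρ₂ : ℂ) * (lam n : ℂ) ^ (-(ℓ : ℤ)) * f4 n x
  eq5 : ∀ n, ∀ x ∈ Ioo (0 : ℝ) β ∪ Ioo β L,
      Complex.I * (lam n : ℂ) * v5 n x - v6 n x = (lam n : ℂ) ^ (-(ℓ : ℤ)) * f5 n x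
  eq6 : ∀ n, ∀ x ∈ Ioo (0 : ℝ) β ∪ Ioo β L,
      Complex.I * (lam n : ℂ) * (ρ₁ : ℂ) * v6 n x
        - (k₃ : ℂ) * deriv (fun y => deriv (v5 n) y - (l : ℂ) * v1 n y) x
        + (l : ℂ) * (k₁ : ℂ) * (deriv (v1 n) x + v3 n x + (l : ℂ) * v5 n x)
        + (if x < β then (a₀ : ℂ) else 0) * v6 n x
        = (ρ₁ : ℂ) * (lam n : ℂ) ^ (-(ℓ : ℤ)) * f6 n x
  normU : ∀ n, (∫ x in (0 : ℝ)..L,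
      (k₁ * ‖deriv (v1 n) x + v3 n x + (l : ℂ) * v5 n x‖ ^ 2 + ρ₁ * ‖v2 n x‖ ^ 2
        + k₂ * ‖deriv (v3 n) x‖ ^ 2 + ρ₂ * ‖v4 n x‖ ^ 2
        + k₃ * ‖deriv (v5 n) x - (l : ℂ) * v1 n x‖ ^ 2 + ρ₁ * ‖v6 n x‖ ^ 2)) = 1
  normF : Tendsto (fun n => ∫ x in (0 : ℝ)..L,
      (k₁ * ‖deriv (f1 n) x + f3 n x + (l : ℂ) * f5 n x‖ ^ 2 + ρ₁ * ‖f2 n x‖ ^ 2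
        + k₂ * ‖deriv (f3 n) x‖ ^ 2 + ρ₂ * ‖f4 n x‖ ^ 2
        + k₃ * ‖deriv (f5 n) x - (l : ℂ) * f1 n x‖ ^ 2 + ρ₁ * ‖f6 n x‖ ^ 2))
      atTop (nhds 0)


/-! ### Auxiliary calculus of small and bounded sequences of functions -/

/-- Two-sided Gronwall inequality in the space variable. -/
theorem bx_gronwall {L β C : ℝ} (hC : 0 ≤ C) (hb : 0 < β) (hbL : β < L) {E E' g : ℝ → ℝ}
    (hE : Continuous E) (hg : Continuous g) (hE0 : ∀ x, 0 ≤ E x) (hg0 : ∀ x, 0 ≤ g x)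
    (hd : ∀ x ∈ Ioo 0 β ∪ Ioo β L, HasDerivAt E (E' x) x)
    (hle : ∀ x ∈ Ioo 0 β ∪ Ioo β L, |E' x| ≤ C * E x + g x) :
    ∀ x ∈ Icc 0 L, ∀ y ∈ Icc 0 L, E x ≤ Real.exp (C * L) * (E y + ∫ t in (0:ℝ)..L, g t) := by
  have hprim : ∀ x, HasDerivAt (fun u => ∫ t in (0:ℝ)..u, g t) (g x) x := fun x =>
    intervalIntegral.integral_hasDerivAt_right (hg.intervalIntegrable _ _)
      hg.stronglyMeasurable.stronglyMeasurableAtFilter hg.continuousAt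
  have hprimc : Continuous (fun u => ∫ t in (0:ℝ)..u, g t) :=
    continuous_iff_continuousAt.2 fun x => (hprim x).continuousAt
  have hanti : ∀ h h' : ℝ → ℝ, Continuous h →
      (∀ x ∈ Ioo 0 β ∪ Ioo β L, HasDerivAt h (h' x) x) →
      (∀ x ∈ Ioo 0 β ∪ Ioo β L, h' x ≤ 0) → AntitoneOn h (Icc 0 L) := by
    intro h h' hc hd hn
    have h1 : AntitoneOn h (Icc 0 β) := by
      apply antitoneOn_of_deriv_nonpos (convex_Icc _ _) hc.continuousOn
      · rw [interior_Icc]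
        intro x hx
        exact (hd x (Or.inl hx)).differentiableAt.differentiableWithinAt
      · rw [interior_Icc]
        intro x hx
        rw [(hd x (Or.inl hx)).deriv]
        exact hn x (Or.inl hx)
    have h2 : AntitoneOn h (Icc β L) := by
      apply antitoneOn_of_deriv_nonpos (convex_Icc _ _) hc.continuousOn
      · rw [interior_Icc]
        intro x hx
        exact (hd x (Or.inr hx)).differentiableAt.differentiableWithinAt
      · rw [interior_Icc]
        intro x hx
        rw [(hd x (Or.inr hx)).deriv]
        exact hn x (Or.inr hx)
    have := h1.union_right h2 (c := β) (isGreatest_Icc hb.le) (isLeast_Icc hbL.le)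
    rwa [Icc_union_Icc_eq_Icc hb.le hbL.le] at this
  have hmem : ∀ x ∈ Ioo 0 β ∪ Ioo β L, 0 ≤ x ∧ x ≤ L := by
    rintro x (hx | hx)
    · exact ⟨hx.1.le, hx.2.le.trans hbL.le⟩
    · exact ⟨hb.le.trans hx.1.le, hx.2.le⟩
  have hpm : ∀ x y, x ≤ y → (∫ t in (0:ℝ)..x, g t) ≤ ∫ t in (0:ℝ)..y, g t := by
    intro x y hxy
    have := intervalIntegral.integral_add_adjacent_intervals
      (hg.intervalIntegrable (μ := volume) 0 x) (hg.intervalIntegrable (μ := volume) x y)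
    have h2 : 0 ≤ ∫ t in x..y, g t := intervalIntegral.integral_nonneg hxy (fun u _ => hg0 u)
    linarith
  have hp0 : ∀ x, 0 ≤ x → 0 ≤ ∫ t in (0:ℝ)..x, g t := fun x hx =>
    intervalIntegral.integral_nonneg hx (fun u _ => hg0 u)
  intro x hx y hy
  rcases le_total y x with hyx | hxy
  · have key := hanti (fun t => Real.exp (-(C * t)) * E t - ∫ s in (0:ℝ)..t, g s)
      (fun t => (Real.exp (-(C * t)) * (-(C * 1)) * E t + Real.exp (-(C * t)) * E' t) - g t)
      (by fun_prop)
      (fun t ht => by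
        have h1 : HasDerivAt (fun t : ℝ => Real.exp (-(C * t)))
          (Real.exp (-(C * t)) * (-(C * 1))) t := (((hasDerivAt_id t).const_mul C).neg).exp
        exact (h1.mul (hd t ht)).sub (hprim t))
      (fun t ht => by
        have h1 := (abs_le.1 (hle t ht)).2
        have h2 : Real.exp (-(C * t)) ≤ 1 := by
          rw [Real.exp_le_one_iff]
          have := mul_nonneg hC (hmem t ht).1
          linarith
        have h3 := Real.exp_pos (-(C * t))
        have h4 := mul_le_mul_of_nonneg_left h1 h3.le
        have h5 := mul_le_mul_of_nonneg_right h2 (hg0 t)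
        nlinarith) hy hx hyx
    simp only at key
    have e1 : Real.exp (-(C * y)) ≤ 1 := by
      rw [Real.exp_le_one_iff]
      have := mul_nonneg hC hy.1
      linarith
    have e2 := mul_le_mul_of_nonneg_right e1 (hE0 y)
    have e3 := hpm x L hx.2
    have e4 := hp0 y hy.1
    have e5 : Real.exp (-(C * x)) * E x ≤ E y + ∫ t in (0:ℝ)..L, g t := by linarith
    have e6 : E x ≤ Real.exp (C * x) * (E y + ∫ t in (0:ℝ)..L, g t) := by
      have := mul_le_mul_of_nonneg_left e5 (Real.exp_pos (C * x)).le
      rwa [← mul_assoc, ← Real.exp_add, add_neg_cancel, Real.exp_zero, one_mul] at this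
    refine e6.trans (mul_le_mul_of_nonneg_right ?_ ?_)
    · exact Real.exp_le_exp.2 (mul_le_mul_of_nonneg_left hx.2 hC)
    · exact add_nonneg (hE0 y) (hp0 L (hx.1.trans hx.2))
  · have key := hanti (fun t => -(Real.exp (C * t) * E t + Real.exp (C * L) *
        ∫ s in (0:ℝ)..t, g s))
      (fun t => -((Real.exp (C * t) * (C * 1) * E t + Real.exp (C * t) * E' t)
        + Real.exp (C * L) * g t))
      (by fun_prop)
      (fun t ht => by
        have h1 : HasDerivAt (fun t : ℝ => Real.exp (C * t))
          (Real.exp (C * t) * (C * 1)) t := (((hasDerivAt_id t).const_mul C)).exp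
        exact ((h1.mul (hd t ht)).add ((hprim t).const_mul _)).neg)
      (fun t ht => by
        have h1 := (abs_le.1 (hle t ht)).1
        have h2 : Real.exp (C * t) ≤ Real.exp (C * L) :=
          Real.exp_le_exp.2 (mul_le_mul_of_nonneg_left (hmem t ht).2 hC)
        have h3 := Real.exp_pos (C * t)
        have h4 := mul_le_mul_of_nonneg_left h1 h3.le
        have h5 := mul_le_mul_of_nonneg_right h2 (hg0 t)
        nlinarith) hx hy hxy
    simp only at key
    have e1 : 1 ≤ Real.exp (C * x) := by
      exact Real.one_le_exp (mul_nonneg hC hx.1)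
    have e2 := mul_le_mul_of_nonneg_right e1 (hE0 x)
    have e3 := mul_le_mul_of_nonneg_left (hpm y L hy.2) (Real.exp_pos (C * L)).le
    have e4 := mul_nonneg (Real.exp_pos (C * L)).le (hp0 x hx.1)
    have e5 : Real.exp (C * y) * E y ≤ Real.exp (C * L) * E y :=
      mul_le_mul_of_nonneg_right (Real.exp_le_exp.2 (mul_le_mul_of_nonneg_left hy.2 hC)) (hE0 y)
    linarith

/-- Uniformly bounded sequence of continuous functions on `[0,b]`. -/
def BxBd (b : ℝ) (f : ℕ → ℝ → ℂ) : Prop :=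
  (∀ n, Continuous (f n)) ∧ ∃ M, 0 ≤ M ∧ ∀ n, ∀ x ∈ Icc 0 b, ‖f n x‖ ≤ M

/-- Sequence of continuous functions tending to zero in `L¹(0,b)`. -/
def BxSm (b : ℝ) (f : ℕ → ℝ → ℂ) : Prop :=
  (∀ n, Continuous (f n)) ∧ Tendsto (fun n => ∫ x in (0:ℝ)..b, ‖f n x‖) atTop (nhds 0)

theorem BxBd.fix {b : ℝ} {f : ℝ → ℂ} (hf : Continuous f) : BxBd b (fun _ x => f x) := by
  refine ⟨fun _ => hf, ?_⟩
  obtain ⟨M, hM⟩ := (isCompact_Icc (a := (0:ℝ)) (b := b)).exists_bound_of_continuousOn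
    hf.continuousOn
  exact ⟨max M 0, le_max_right _ _, fun n x hx => (hM x hx).trans (le_max_left _ _)⟩

theorem BxBd.add {b : ℝ} {f g : ℕ → ℝ → ℂ} (hf : BxBd b f) (hg : BxBd b g) :
    BxBd b (fun n x => f n x + g n x) := by
  obtain ⟨hf, M, hM, h1⟩ := hf
  obtain ⟨hg, N, hN, h2⟩ := hg
  exact ⟨fun n => (hf n).add (hg n), M + N, by positivity, fun n x hx =>
    (norm_add_le _ _).trans (add_le_add (h1 n x hx) (h2 n x hx))⟩

theorem BxBd.neg {b : ℝ} {f : ℕ → ℝ → ℂ} (hf : BxBd b f) :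
    BxBd b (fun n x => -f n x) := by
  obtain ⟨hf, M, hM, h1⟩ := hf
  exact ⟨fun n => (hf n).neg, M, hM, fun n x hx => by rw [norm_neg]; exact h1 n x hx⟩

theorem BxBd.sub {b : ℝ} {f g : ℕ → ℝ → ℂ} (hf : BxBd b f) (hg : BxBd b g) :
    BxBd b (fun n x => f n x - g n x) := by
  simpa [sub_eq_add_neg] using hf.add hg.neg

theorem BxBd.mul {b : ℝ} {f g : ℕ → ℝ → ℂ} (hf : BxBd b f) (hg : BxBd b g) :
    BxBd b (fun n x => f n x * g n x) := by
  obtain ⟨hf, M, hM, h1⟩ := hf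
  obtain ⟨hg, N, hN, h2⟩ := hg
  exact ⟨fun n => (hf n).mul (hg n), M * N, by positivity, fun n x hx => by
    rw [norm_mul]; exact mul_le_mul (h1 n x hx) (h2 n x hx) (norm_nonneg _) hM⟩

theorem BxBd.star {b : ℝ} {f : ℕ → ℝ → ℂ} (hf : BxBd b f) :
    BxBd b (fun n x => star (f n x)) := by
  obtain ⟨hf, M, hM, h1⟩ := hf
  exact ⟨fun n => (hf n).star, M, hM, fun n x hx => by rw [norm_star]; exact h1 n x hx⟩

theorem BxSm.add {b : ℝ} (hb : 0 ≤ b) {f g : ℕ → ℝ → ℂ} (hf : BxSm b f) (hg : BxSm b g) :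
    BxSm b (fun n x => f n x + g n x) := by
  refine ⟨fun n => (hf.1 n).add (hg.1 n), ?_⟩
  have := hf.2.add hg.2
  rw [add_zero] at this
  refine squeeze_zero (fun n => intervalIntegral.integral_nonneg hb fun _ _ => norm_nonneg _)
    (fun n => ?_) this
  have c1 := hf.1 n
  have c2 := hg.1 n
  rw [← intervalIntegral.integral_add (c1.norm.intervalIntegrable _ _)
    (c2.norm.intervalIntegrable _ _)]
  exact intervalIntegral.integral_mono_on hb ((c1.add c2).norm.intervalIntegrable _ _)
    ((c1.norm.add c2.norm).intervalIntegrable _ _) (fun x _ => norm_add_le _ _)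

theorem BxSm.neg {b : ℝ} {f : ℕ → ℝ → ℂ} (hf : BxSm b f) :
    BxSm b (fun n x => -f n x) := by
  refine ⟨fun n => (hf.1 n).neg, ?_⟩
  simpa using hf.2

theorem BxSm.star {b : ℝ} {f : ℕ → ℝ → ℂ} (hf : BxSm b f) :
    BxSm b (fun n x => star (f n x)) := by
  refine ⟨fun n => (hf.1 n).star, ?_⟩
  simpa only [norm_star] using hf.2

theorem BxSm.sub {b : ℝ} (hb : 0 ≤ b) {f g : ℕ → ℝ → ℂ} (hf : BxSm b f) (hg : BxSm b g) :
    BxSm b (fun n x => f n x - g n x) := by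
  simpa [sub_eq_add_neg] using hf.add hb hg.neg

theorem BxSm.bmul {b : ℝ} (hb : 0 ≤ b) {f g : ℕ → ℝ → ℂ} (hf : BxBd b f) (hg : BxSm b g) :
    BxSm b (fun n x => f n x * g n x) := by
  obtain ⟨hf, M, hM, h1⟩ := hf
  refine ⟨fun n => (hf n).mul (hg.1 n), ?_⟩
  have := hg.2.const_mul M
  rw [mul_zero] at this
  refine squeeze_zero (fun n => intervalIntegral.integral_nonneg hb fun _ _ => norm_nonneg _)
    (fun n => ?_) this
  rw [← intervalIntegral.integral_const_mul]
  have c1 := hf n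
  have c2 := hg.1 n
  refine intervalIntegral.integral_mono_on hb ((c1.mul c2).norm.intervalIntegrable _ _)
    ((c2.norm.const_mul M).intervalIntegrable _ _) (fun x hx => ?_)
  rw [norm_mul]
  exact mul_le_mul_of_nonneg_right (h1 n x hx) (norm_nonneg _)

theorem BxSm.mulb {b : ℝ} (hb : 0 ≤ b) {f g : ℕ → ℝ → ℂ} (hf : BxSm b f) (hg : BxBd b g) :
    BxSm b (fun n x => f n x * g n x) := by
  simpa only [mul_comm] using BxSm.bmul hb hg hf

theorem BxSm.restrict {b c : ℝ} (hb : 0 ≤ b) (hbc : b ≤ c) {f : ℕ → ℝ → ℂ} (hf : BxSm c f) :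
    BxSm b f := by
  refine ⟨hf.1, squeeze_zero (fun n => intervalIntegral.integral_nonneg hb
    fun _ _ => norm_nonneg _) (fun n => ?_) hf.2⟩
  have h := (hf.1 n).norm
  have := intervalIntegral.integral_add_adjacent_intervals
      (h.intervalIntegrable (μ := volume) 0 b) (h.intervalIntegrable (μ := volume) b c)
  have h2 : 0 ≤ ∫ t in b..c, ‖f n t‖ :=
    intervalIntegral.integral_nonneg hbc (fun u _ => norm_nonneg _)
  linarith

theorem BxBd.restrict {b c : ℝ} (hbc : b ≤ c) {f : ℕ → ℝ → ℂ} (hf : BxBd c f) :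
    BxBd b f := by
  obtain ⟨hf, M, hM, h1⟩ := hf
  exact ⟨hf, M, hM, fun n x hx => h1 n x ⟨hx.1, hx.2.trans hbc⟩⟩

theorem BxSm.of_sup {b : ℝ} (hb : 0 ≤ b) {f : ℕ → ℝ → ℂ} (hf : ∀ n, Continuous (f n))
    {s : ℕ → ℝ} (hs : Tendsto s atTop (nhds 0)) (h : ∀ n, ∀ x ∈ Icc 0 b, ‖f n x‖ ≤ s n) :
    BxSm b f := by
  refine ⟨hf, ?_⟩
  have := hs.const_mul b
  rw [mul_zero] at this
  refine squeeze_zero (fun n => intervalIntegral.integral_nonneg hb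
    fun _ _ => norm_nonneg _) (fun n => ?_) this
  have := intervalIntegral.integral_mono_on hb ((hf n).norm.intervalIntegrable (μ := volume) 0 b)
    (continuous_const.intervalIntegrable _ _) (h n)
  simpa using this

theorem BxSm.of_sq {b : ℝ} (hb : 0 ≤ b) {f : ℕ → ℝ → ℂ} (hf : ∀ n, Continuous (f n))
    (h : Tendsto (fun n => ∫ x in (0:ℝ)..b, ‖f n x‖ ^ 2) atTop (nhds 0)) :
    BxSm b f := by
  refine ⟨hf, ?_⟩
  have hs : Tendsto (fun n => Real.sqrt (b * ∫ x in (0:ℝ)..b, ‖f n x‖ ^ 2)) atTop (nhds 0) := by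
    have := (Real.continuous_sqrt.tendsto _).comp (h.const_mul b)
    simpa [Function.comp_def] using this
  refine squeeze_zero (fun n => intervalIntegral.integral_nonneg hb
    fun _ _ => norm_nonneg _) (fun n => ?_) hs
  apply Real.le_sqrt_of_sq_le
  set I := ∫ x in (0:ℝ)..b, ‖f n x‖ with hI
  set J := ∫ x in (0:ℝ)..b, ‖f n x‖ ^ 2 with hJ
  have c := (hf n).norm
  rcases hb.eq_or_lt with rfl | hb'
  · simp [hI]
  have h0 : 0 ≤ ∫ x in (0:ℝ)..b, (‖f n x‖ - I / b) ^ 2 :=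
    intervalIntegral.integral_nonneg hb fun _ _ => sq_nonneg _
  have e : (∫ x in (0:ℝ)..b, (‖f n x‖ - I / b) ^ 2) = J - 2 * (I / b) * I + b * (I / b) ^ 2 := by
    have : ∀ x, (‖f n x‖ - I / b) ^ 2 = (‖f n x‖ ^ 2 - 2 * (I / b) * ‖f n x‖) + (I / b) ^ 2 := by
      intro x; ring
    simp_rw [this]
    rw [intervalIntegral.integral_add, intervalIntegral.integral_sub,
      intervalIntegral.integral_const_mul, intervalIntegral.integral_const]
    · simp [hI, hJ]
    all_goals exact Continuous.intervalIntegrable (by fun_prop) _ _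
  rw [e] at h0
  have h1 : J - 2 * (I / b) * I + b * (I / b) ^ 2 = J - I ^ 2 / b := by
    field_simp; ring
  rw [h1] at h0
  have : I ^ 2 / b ≤ J := by linarith
  rw [div_le_iff₀ hb'] at this
  linarith

/-- One multiplier step. -/
theorem bx_step {b c : ℝ} (hb : 0 ≤ b) (hc : c ≠ 0) {Φ R h : ℕ → ℝ → ℂ}
    (hΦ : ∀ n, Continuous (Φ n)) (hh : ∀ n, Continuous (h n)) (hR : BxSm b R)
    (hd : ∀ n, ∀ x ∈ Ioo 0 b, HasDerivAt (Φ n) ((c : ℂ) * (h n x * star (h n x)) + R n x) x)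
    (hbd : Tendsto (fun n => Φ n b - Φ n 0) atTop (nhds 0)) :
    BxSm b h ∧ Tendsto (fun n => ∫ x in (0:ℝ)..b, ‖h n x‖ ^ 2) atTop (nhds 0) := by
  have main : Tendsto (fun n => ∫ x in (0:ℝ)..b, ‖h n x‖ ^ 2) atTop (nhds 0) := by
    have h1 := (hbd.norm.add hR.2).const_mul |c|⁻¹
    simp only [norm_zero, add_zero, mul_zero] at h1
    refine squeeze_zero (fun n => intervalIntegral.integral_nonneg hb
      fun _ _ => by positivity) (fun n => ?_) h1
    have cR := hR.1 n
    have ch := hh n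
    have ftc := intervalIntegral.integral_eq_sub_of_hasDerivAt_of_le hb (hΦ n).continuousOn
      (hd n) (Continuous.intervalIntegrable (by fun_prop) _ _)
    have e : ∀ x, h n x * star (h n x) = ((‖h n x‖ ^ 2 : ℝ) : ℂ) := by
      intro x
      rw [Complex.star_def, Complex.mul_conj, Complex.normSq_eq_norm_sq]
    rw [intervalIntegral.integral_add (Continuous.intervalIntegrable (by fun_prop) _ _)
      (Continuous.intervalIntegrable (by fun_prop) _ _), intervalIntegral.integral_const_mul] at ftc
    simp_rw [e] at ftc
    rw [intervalIntegral.integral_ofReal] at ftc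
    have f2 : ((c * ∫ x in (0:ℝ)..b, ‖h n x‖ ^ 2 : ℝ) : ℂ)
        = (Φ n b - Φ n 0) - ∫ x in (0:ℝ)..b, R n x := by
      rw [← ftc]; push_cast; ring
    have f3 := congrArg norm f2
    rw [Complex.norm_real, norm_mul, Real.norm_eq_abs, Real.norm_eq_abs] at f3
    have f4 : |c| * |∫ x in (0:ℝ)..b, ‖h n x‖ ^ 2| ≤
        ‖Φ n b - Φ n 0‖ + ∫ x in (0:ℝ)..b, ‖R n x‖ := by
      rw [f3]
      exact (norm_sub_le _ _).trans
        (add_le_add_right (intervalIntegral.norm_integral_le_integral_norm hb) _)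
    rw [inv_mul_eq_div, le_div_iff₀ (abs_pos.2 hc)]
    nlinarith [le_abs_self (∫ x in (0:ℝ)..b, ‖h n x‖ ^ 2), abs_nonneg c]
  exact ⟨BxSm.of_sq hb hh main, main⟩

/-! ### The normalised system -/

theorem bx_ip_le (a b : ℂ) : |2 * inner ℝ a b| ≤ ‖a‖ ^ 2 + ‖b‖ ^ 2 := by
  have h := abs_real_inner_le_norm a b
  rw [abs_mul, abs_two]
  nlinarith [sq_nonneg (‖a‖ - ‖b‖)]

theorem bx_ip_real (a b : ℂ) (s : ℝ) : inner ℝ a ((s : ℂ) * b) = s * inner ℝ a b := by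
  rw [← Complex.real_smul, real_inner_smul_right]

theorem bx_ip_skew (a b : ℂ) (s : ℝ) :
    inner ℝ a (Complex.I * (s : ℂ) * b) = - inner ℝ b (Complex.I * (s : ℂ) * a) := by
  simp only [Complex.inner, Complex.mul_re, Complex.mul_im, Complex.I_re, Complex.I_im,
    Complex.ofReal_re, Complex.ofReal_im, Complex.conj_re, Complex.conj_im]
  ring

theorem bx_norm3 (a b c : ℂ) (l : ℝ) :
    ‖a + b + (l : ℂ) * c‖ ^ 2 ≤ 3 * (‖a‖ ^ 2 + ‖b‖ ^ 2 + l ^ 2 * ‖c‖ ^ 2) := by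
  have h := norm_add₃_le (a := a) (b := b) (c := (l : ℂ) * c)
  have h2 : ‖(l : ℂ) * c‖ ^ 2 = l ^ 2 * ‖c‖ ^ 2 := by
    rw [norm_mul, mul_pow, Complex.norm_real, Real.norm_eq_abs, sq_abs]
  have h3 := pow_le_pow_left₀ (norm_nonneg _) h 2
  rw [← h2]
  nlinarith [sq_nonneg (‖a‖ - ‖b‖), sq_nonneg (‖a‖ - ‖(l : ℂ) * c‖),
    sq_nonneg (‖b‖ - ‖(l : ℂ) * c‖)]

theorem bx_norm2 (a c : ℂ) (l : ℝ) :
    ‖a - (l : ℂ) * c‖ ^ 2 ≤ 3 * (‖a‖ ^ 2 + l ^ 2 * ‖c‖ ^ 2) := by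
  have := bx_norm3 a 0 c (-l)
  simpa [sub_eq_add_neg] using this

/-- Data of the normalised first order system at one frequency. -/
structure BxD (l κ α β L : ℝ) where
  lam : ℝ
  u : ℝ → ℂ
  ψ : ℝ → ℂ
  w : ℝ → ℂ
  p : ℝ → ℂ
  q : ℝ → ℂ
  r : ℝ → ℂ
  U : ℝ → ℂ
  V : ℝ → ℂ
  W : ℝ → ℂ
  f1 : ℝ → ℂ
  f2 : ℝ → ℂ
  f3 : ℝ → ℂ
  f4 : ℝ → ℂ
  f5 : ℝ → ℂ
  f6 : ℝ → ℂ
  g1 : ℝ → ℂ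
  g3 : ℝ → ℂ
  g5 : ℝ → ℂ
  cu : Continuous u
  cψ : Continuous ψ
  cw : Continuous w
  cp : Continuous p
  cq : Continuous q
  cr : Continuous r
  cf1 : Continuous f1
  cf2 : Continuous f2
  cf3 : Continuous f3
  cf4 : Continuous f4
  cf5 : Continuous f5
  cf6 : Continuous f6
  cg1 : Continuous g1
  cg3 : Continuous g3
  cg5 : Continuous g5
  lam_ne : lam ≠ 0
  hU : ∀ x, U x = Complex.I * (lam : ℂ) * u x - f1 x
  hV : ∀ x, V x = Complex.I * (lam : ℂ) * ψ x - f3 x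
  hW : ∀ x, W x = Complex.I * (lam : ℂ) * w x - f5 x
  du : ∀ x ∈ Ioo 0 L, HasDerivAt u (p x) x
  dψ : ∀ x ∈ Ioo 0 L, HasDerivAt ψ (q x) x
  dw : ∀ x ∈ Ioo 0 L, HasDerivAt w (r x) x
  df1 : ∀ x ∈ Ioo 0 L, HasDerivAt f1 (g1 x) x
  df3 : ∀ x ∈ Ioo 0 L, HasDerivAt f3 (g3 x) x
  df5 : ∀ x ∈ Ioo 0 L, HasDerivAt f5 (g5 x) x
  dp : ∀ x ∈ Ioo 0 β ∪ Ioo β L, HasDerivAt p (Complex.I * (lam : ℂ) * U x - q x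
    - ((2 * l : ℝ) : ℂ) * r x + ((l ^ 2 : ℝ) : ℂ) * u x - f2 x) x
  dq : ∀ x ∈ Ioo 0 β ∪ Ioo β L, HasDerivAt q (Complex.I * (lam : ℂ) * V x
    + (κ : ℂ) * (p x + ψ x + (l : ℂ) * w x) - f4 x) x
  dr : ∀ x ∈ Ioo 0 β ∪ Ioo β L, HasDerivAt r (Complex.I * (lam : ℂ) * W x
    + ((2 * l : ℝ) : ℂ) * p x + (l : ℂ) * ψ x + ((l ^ 2 : ℝ) : ℂ) * w x
    + ((if x < β then α else 0 : ℝ) : ℂ) * W x - f6 x) x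
  u0 : u 0 = 0
  ψ0 : ψ 0 = 0
  w0 : w 0 = 0
  f10 : f1 0 = 0
  f30 : f3 0 = 0
  f50 : f5 0 = 0
  uL : u L = 0
  ψL : ψ L = 0
  wL : w L = 0
  f1L : f1 L = 0
  f3L : f3 L = 0
  f5L : f5 L = 0

namespace BxD

variable {l κ α β L : ℝ}

theorem cU (D : BxD l κ α β L) : Continuous D.U := by
  have := D.cu
  have := D.cf1
  rw [funext D.hU]
  fun_prop

theorem cV (D : BxD l κ α β L) : Continuous D.V := by
  have := D.cψ
  have := D.cf3
  rw [funext D.hV]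
  fun_prop

theorem cW (D : BxD l κ α β L) : Continuous D.W := by
  have := D.cw
  have := D.cf5
  rw [funext D.hW]
  fun_prop

theorem dU (D : BxD l κ α β L) : ∀ x ∈ Ioo 0 L,
    HasDerivAt D.U (Complex.I * (D.lam : ℂ) * D.p x - D.g1 x) x := by
  intro x hx
  rw [funext D.hU]
  exact ((D.du x hx).const_mul _).sub (D.df1 x hx)

theorem dV (D : BxD l κ α β L) : ∀ x ∈ Ioo 0 L,
    HasDerivAt D.V (Complex.I * (D.lam : ℂ) * D.q x - D.g3 x) x := by
  intro x hx
  rw [funext D.hV]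
  exact ((D.dψ x hx).const_mul _).sub (D.df3 x hx)

theorem dW (D : BxD l κ α β L) : ∀ x ∈ Ioo 0 L,
    HasDerivAt D.W (Complex.I * (D.lam : ℂ) * D.r x - D.g5 x) x := by
  intro x hx
  rw [funext D.hW]
  exact ((D.dw x hx).const_mul _).sub (D.df5 x hx)

/-- Energy density. -/
def NU (D : BxD l κ α β L) (x : ℝ) : ℝ :=
  ‖D.p x + D.ψ x + (l : ℂ) * D.w x‖ ^ 2 + ‖D.U x‖ ^ 2 + ‖D.q x‖ ^ 2 + ‖D.V x‖ ^ 2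
    + ‖D.r x - (l : ℂ) * D.u x‖ ^ 2 + ‖D.W x‖ ^ 2

/-- Energy density of the data. -/
def NF (D : BxD l κ α β L) (x : ℝ) : ℝ :=
  ‖D.g1 x + D.f3 x + (l : ℂ) * D.f5 x‖ ^ 2 + ‖D.f2 x‖ ^ 2 + ‖D.g3 x‖ ^ 2 + ‖D.f4 x‖ ^ 2
    + ‖D.g5 x - (l : ℂ) * D.f1 x‖ ^ 2 + ‖D.f6 x‖ ^ 2

/-- Full pointwise energy. -/
def E (D : BxD l κ α β L) (x : ℝ) : ℝ :=
  ‖D.U x‖ ^ 2 + ‖D.p x‖ ^ 2 + (‖D.V x‖ ^ 2 + ‖D.q x‖ ^ 2) + (‖D.W x‖ ^ 2 + ‖D.r x‖ ^ 2)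
    + (‖D.u x‖ ^ 2 + ‖D.ψ x‖ ^ 2 + ‖D.w x‖ ^ 2)

/-- Full pointwise size of the data. -/
def G (D : BxD l κ α β L) (x : ℝ) : ℝ :=
  ‖D.g1 x‖ ^ 2 + ‖D.f2 x‖ ^ 2 + ‖D.g3 x‖ ^ 2 + ‖D.f4 x‖ ^ 2 + ‖D.g5 x‖ ^ 2 + ‖D.f6 x‖ ^ 2

theorem cNU (D : BxD l κ α β L) : Continuous D.NU := by
  have := D.cu; have := D.cψ; have := D.cw; have := D.cp; have := D.cq; have := D.cr
  have := D.cU; have := D.cV; have := D.cW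
  unfold NU
  fun_prop

theorem cE (D : BxD l κ α β L) : Continuous D.E := by
  have := D.cu; have := D.cψ; have := D.cw; have := D.cp; have := D.cq; have := D.cr
  have := D.cU; have := D.cV; have := D.cW
  unfold E
  fun_prop

theorem cNF (D : BxD l κ α β L) : Continuous D.NF := by
  have := D.cf1; have := D.cf2; have := D.cf3; have := D.cf4; have := D.cf5; have := D.cf6
  have := D.cg1; have := D.cg3; have := D.cg5
  unfold NF
  fun_prop

theorem cG (D : BxD l κ α β L) : Continuous D.G := by
  have := D.cf2; have := D.cf4; have := D.cf6
  have := D.cg1; have := D.cg3; have := D.cg5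
  unfold G
  fun_prop

theorem E_nonneg (D : BxD l κ α β L) (x : ℝ) : 0 ≤ D.E x := by unfold E; positivity
theorem G_nonneg (D : BxD l κ α β L) (x : ℝ) : 0 ≤ D.G x := by unfold G; positivity
theorem NU_nonneg (D : BxD l κ α β L) (x : ℝ) : 0 ≤ D.NU x := by unfold NU; positivity
theorem NF_nonneg (D : BxD l κ α β L) (x : ℝ) : 0 ≤ D.NF x := by unfold NF; positivity

set_option maxHeartbeats 4000000 in
theorem gron (D : BxD l κ α β L) (hl : 0 < l) (hκ : 0 < κ) (hα : 0 < α) (hb : 0 < β)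
    (hbL : β < L) : ∀ x ∈ Icc 0 L, ∀ y ∈ Icc 0 L,
      D.E x ≤ Real.exp ((12 + 2 * l ^ 2 + l + 2 * κ + κ * l + α) * L)
        * (D.E y + ∫ t in (0:ℝ)..L, D.G t) := by
  refine bx_gronwall (by positivity) hb hbL D.cE D.cG D.E_nonneg D.G_nonneg (E' := fun x =>
    2 * inner ℝ (D.U x) (Complex.I * (D.lam : ℂ) * D.p x - D.g1 x)
    + 2 * inner ℝ (D.p x) (Complex.I * (D.lam : ℂ) * D.U x - D.q x
    - ((2 * l : ℝ) : ℂ) * D.r x + ((l ^ 2 : ℝ) : ℂ) * D.u x - D.f2 x)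
    + (2 * inner ℝ (D.V x) (Complex.I * (D.lam : ℂ) * D.q x - D.g3 x)
    + 2 * inner ℝ (D.q x) (Complex.I * (D.lam : ℂ) * D.V x
    + (κ : ℂ) * (D.p x + D.ψ x + (l : ℂ) * D.w x) - D.f4 x))
    + (2 * inner ℝ (D.W x) (Complex.I * (D.lam : ℂ) * D.r x - D.g5 x)
    + 2 * inner ℝ (D.r x) (Complex.I * (D.lam : ℂ) * D.W x
    + ((2 * l : ℝ) : ℂ) * D.p x + (l : ℂ) * D.ψ x + ((l ^ 2 : ℝ) : ℂ) * D.w x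
    + ((if x < β then α else 0 : ℝ) : ℂ) * D.W x - D.f6 x))
    + (2 * inner ℝ (D.u x) (D.p x) + 2 * inner ℝ (D.ψ x) (D.q x) + 2 * inner ℝ (D.w x) (D.r x)))
    ?_ ?_
  · intro x hx
    have hxL : x ∈ Ioo 0 L := by
      rcases hx with hx | hx
      · exact ⟨hx.1, hx.2.trans hbL⟩
      · exact ⟨hb.trans hx.1, hx.2⟩
    exact ((((D.dU x hxL).norm_sq.add (D.dp x hx).norm_sq).add
      ((D.dV x hxL).norm_sq.add (D.dq x hx).norm_sq)).add
      ((D.dW x hxL).norm_sq.add (D.dr x hx).norm_sq)).add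
      (((D.du x hxL).norm_sq.add (D.dψ x hxL).norm_sq).add (D.dw x hxL).norm_sq)
  · intro x hx
    simp only [inner_add_right, inner_sub_right, bx_ip_real, bx_ip_skew (D.U x),
      bx_ip_skew (D.V x), bx_ip_skew (D.W x), mul_add]
    generalize hs : (if x < β then α else 0 : ℝ) = s
    have hs0 : 0 ≤ s := by rw [← hs]; split_ifs <;> linarith
    have hs1 : s ≤ α := by rw [← hs]; split_ifs <;> linarith
    have b1 := abs_le.1 (bx_ip_le (D.U x) (D.g1 x))
    have b2 := abs_le.1 (bx_ip_le (D.p x) (D.q x))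
    have b3 := bx_ip_le (D.p x) (D.u x)
    have b4 := abs_le.1 (bx_ip_le (D.p x) (D.f2 x))
    have b5 := abs_le.1 (bx_ip_le (D.V x) (D.g3 x))
    have b6 := bx_ip_le (D.q x) (D.p x)
    have b7 := bx_ip_le (D.q x) (D.ψ x)
    have b8 := bx_ip_le (D.q x) (D.w x)
    have b9 := abs_le.1 (bx_ip_le (D.q x) (D.f4 x))
    have b10 := abs_le.1 (bx_ip_le (D.W x) (D.g5 x))
    have b11 := bx_ip_le (D.r x) (D.ψ x)
    have b12 := bx_ip_le (D.r x) (D.w x)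
    have b13 := bx_ip_le (D.r x) (D.W x)
    have b14 := abs_le.1 (bx_ip_le (D.r x) (D.f6 x))
    have b15 := abs_le.1 (bx_ip_le (D.u x) (D.p x))
    have b16 := abs_le.1 (bx_ip_le (D.ψ x) (D.q x))
    have b17 := abs_le.1 (bx_ip_le (D.w x) (D.r x))
    have b18 : inner ℝ (D.r x) (D.p x) = inner ℝ (D.p x) (D.r x) := real_inner_comm _ _
    rw [b18]
    unfold E G
    have n1 := sq_nonneg ‖D.U x‖
    have n2 := sq_nonneg ‖D.p x‖
    have n3 := sq_nonneg ‖D.V x‖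
    have n4 := sq_nonneg ‖D.q x‖
    have n5 := sq_nonneg ‖D.W x‖
    have n6 := sq_nonneg ‖D.r x‖
    have n7 := sq_nonneg ‖D.u x‖
    have n8 := sq_nonneg ‖D.ψ x‖
    have n9 := sq_nonneg ‖D.w x‖
    set EE := ‖D.U x‖ ^ 2 + ‖D.p x‖ ^ 2 + (‖D.V x‖ ^ 2 + ‖D.q x‖ ^ 2) +
      (‖D.W x‖ ^ 2 + ‖D.r x‖ ^ 2) + (‖D.u x‖ ^ 2 + ‖D.ψ x‖ ^ 2 + ‖D.w x‖ ^ 2) with hEE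
    have hEE0 : 0 ≤ EE := by positivity
    have aux : ∀ c t v : ℝ, 0 ≤ c → |2 * t| ≤ v → v ≤ EE →
        -(c * EE) ≤ 2 * (c * t) ∧ 2 * (c * t) ≤ c * EE := by
      intro c t v hc h1 h2
      have h3 := abs_le.1 (h1.trans h2)
      constructor <;> nlinarith
    have c3 := aux (l ^ 2) _ _ (by positivity) b3 (by linarith)
    have c6 := aux κ _ _ hκ.le b6 (by linarith)
    have c7 := aux κ _ _ hκ.le b7 (by linarith)
    have c8 := aux (κ * l) _ _ (by positivity) b8 (by linarith)
    have c11 := aux l _ _ hl.le b11 (by linarith)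
    have c12 := aux (l ^ 2) _ _ (by positivity) b12 (by linarith)
    have c13 := aux s _ _ hs0 b13 (by linarith)
    have c13' : s * EE ≤ α * EE := mul_le_mul_of_nonneg_right hs1 hEE0
    rw [mul_assoc] at c8
    rw [abs_le]
    constructor
    · linarith [c3.1, c6.1, c7.1, c8.1, c11.1, c12.1, c13.1, b1.1, b1.2, b2.1, b2.2, b4.2, b5.2,
        b9.2, b10.2, b14.2, b15.1, b16.1, b17.1]
    · linarith [c3.2, c6.2, c7.2, c8.2, c11.2, c12.2, c13.2, b1.1, b2.1, b4.1, b5.1,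
        b9.1, b10.1, b14.1, b15.2, b16.2, b17.2]

end BxD

/-- Poincare type estimate for the curved derivative. -/
theorem bx_poinc {l β L : ℝ} (hb : 0 < β) (hbL : β < L) {a b c a' b' c' : ℝ → ℂ}
    (ha : Continuous a) (hbc : Continuous b) (hc : Continuous c)
    (ha' : Continuous a') (hb' : Continuous b') (hc' : Continuous c')
    (da : ∀ x ∈ Ioo 0 L, HasDerivAt a (a' x) x) (db : ∀ x ∈ Ioo 0 L, HasDerivAt b (b' x) x)
    (dc : ∀ x ∈ Ioo 0 L, HasDerivAt c (c' x) x) (a0 : a 0 = 0) (b0 : b 0 = 0) (c0 : c 0 = 0) :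
    ∀ x ∈ Icc 0 L, ‖a x‖ ^ 2 + ‖b x‖ ^ 2 + ‖c x‖ ^ 2 ≤ Real.exp (2 * L) *
      ∫ t in (0:ℝ)..L, (‖a' t + b t + (l : ℂ) * c t‖ ^ 2 + ‖b' t‖ ^ 2
        + ‖c' t - (l : ℂ) * a t‖ ^ 2) := by
  intro x hx
  have := bx_gronwall (L := L) (β := β) (C := 2) (by norm_num) hb hbL
    (E := fun x => ‖a x‖ ^ 2 + ‖b x‖ ^ 2 + ‖c x‖ ^ 2)
    (E' := fun x => 2 * inner ℝ (a x) (a' x) + 2 * inner ℝ (b x) (b' x)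
      + 2 * inner ℝ (c x) (c' x))
    (g := fun t => (‖a' t + b t + (l : ℂ) * c t‖ ^ 2 + ‖b' t‖ ^ 2
        + ‖c' t - (l : ℂ) * a t‖ ^ 2)) (by fun_prop) (by fun_prop)
    (fun x => by positivity) (fun x => by positivity)
    (fun x hx => by
      have hxL : x ∈ Ioo 0 L := by
        rcases hx with hx | hx
        · exact ⟨hx.1, hx.2.trans hbL⟩
        · exact ⟨hb.trans hx.1, hx.2⟩
      exact ((da x hxL).norm_sq.add (db x hxL).norm_sq).add (dc x hxL).norm_sq)
    (fun x hx => by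
      have h1 := abs_le.1 (bx_ip_le (a x) (a' x + b x + (l : ℂ) * c x))
      have h2 := abs_le.1 (bx_ip_le (b x) (b' x))
      have h3 := abs_le.1 (bx_ip_le (c x) (c' x - (l : ℂ) * a x))
      have h4 := abs_le.1 (bx_ip_le (a x) (b x))
      have h5 : inner ℝ (c x) (a x) = inner ℝ (a x) (c x) := real_inner_comm _ _
      rw [inner_add_right, inner_add_right, bx_ip_real] at h1
      rw [inner_sub_right, bx_ip_real, h5] at h3
      rw [abs_le]
      constructor <;> nlinarith [sq_nonneg ‖c x‖, sq_nonneg ‖b x‖, sq_nonneg ‖a x‖])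
    x hx 0 ⟨le_rfl, hx.1.trans hx.2⟩
  simpa [a0, b0, c0] using this

/-! ### Uniform bounds and smallness -/

section BxSeq

variable {l κ α β L : ℝ}

theorem BxD.avg (D : BxD l κ α β L) (hl : 0 < l) (hκ : 0 < κ) (hα : 0 < α) (hb : 0 < β)
    (hbL : β < L) {b : ℝ} (hb0 : 0 ≤ b) (hbL' : b ≤ L) {ω : ℝ → ℝ} (hω : Continuous ω)
    (hω0 : ∀ x ∈ Icc 0 b, 0 ≤ ω x) : ∀ x ∈ Icc 0 L,
      (∫ y in (0:ℝ)..b, ω y) * D.E x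
        ≤ Real.exp ((12 + 2 * l ^ 2 + l + 2 * κ + κ * l + α) * L)
        * ((∫ y in (0:ℝ)..b, ω y * D.E y) + (∫ y in (0:ℝ)..b, ω y) * ∫ t in (0:ℝ)..L, D.G t) := by
  intro x hx
  have cE := D.cE
  have h : ∀ y ∈ Icc 0 b, ω y * D.E x ≤
      Real.exp ((12 + 2 * l ^ 2 + l + 2 * κ + κ * l + α) * L) * (ω y * D.E y) +
      Real.exp ((12 + 2 * l ^ 2 + l + 2 * κ + κ * l + α) * L) * (∫ t in (0:ℝ)..L, D.G t) * ω y := by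
    intro y hy
    have := mul_le_mul_of_nonneg_left
      (D.gron hl hκ hα hb hbL x hx y ⟨hy.1, hy.2.trans hbL'⟩) (hω0 y hy)
    linarith
  have h2 := intervalIntegral.integral_mono_on (μ := volume) hb0
    (Continuous.intervalIntegrable (by fun_prop) _ _)
    (Continuous.intervalIntegrable (by fun_prop) _ _) h
  rw [intervalIntegral.integral_mul_const, intervalIntegral.integral_add
    (Continuous.intervalIntegrable (by fun_prop) _ _)
    (Continuous.intervalIntegrable (by fun_prop) _ _), intervalIntegral.integral_const_mul,
    intervalIntegral.integral_const_mul] at h2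
  linarith

theorem BxD.f_sup (D : BxD l κ α β L) (hb : 0 < β) (hbL : β < L) : ∀ x ∈ Icc 0 L,
    ‖D.f1 x‖ ^ 2 + ‖D.f3 x‖ ^ 2 + ‖D.f5 x‖ ^ 2 ≤
      Real.exp (2 * L) * ∫ t in (0:ℝ)..L, D.NF t := by
  intro x hx
  refine (bx_poinc (l := l) hb hbL D.cf1 D.cf3 D.cf5 D.cg1 D.cg3 D.cg5 D.df1 D.df3 D.df5 D.f10
    D.f30 D.f50 x hx).trans (mul_le_mul_of_nonneg_left ?_ (Real.exp_pos _).le)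
  have := D.cf1; have := D.cf3; have := D.cf5
  have := D.cg1; have := D.cg3; have := D.cg5
  refine intervalIntegral.integral_mono_on (hb.trans hbL).le
    (Continuous.intervalIntegrable (by fun_prop) _ _) (D.cNF.intervalIntegrable _ _) ?_
  intro t _
  unfold BxD.NF
  nlinarith [sq_nonneg ‖D.f2 t‖, sq_nonneg ‖D.f4 t‖, sq_nonneg ‖D.f6 t‖]

theorem BxD.u_sup (D : BxD l κ α β L) (hb : 0 < β) (hbL : β < L) : ∀ x ∈ Icc 0 L,
    ‖D.u x‖ ^ 2 + ‖D.ψ x‖ ^ 2 + ‖D.w x‖ ^ 2 ≤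
      Real.exp (2 * L) * ∫ t in (0:ℝ)..L, D.NU t := by
  intro x hx
  refine (bx_poinc (l := l) hb hbL D.cu D.cψ D.cw D.cp D.cq D.cr D.du D.dψ D.dw D.u0
    D.ψ0 D.w0 x hx).trans (mul_le_mul_of_nonneg_left ?_ (Real.exp_pos _).le)
  have := D.cu; have := D.cψ; have := D.cw; have := D.cp; have := D.cq; have := D.cr
  refine intervalIntegral.integral_mono_on (hb.trans hbL).le
    (Continuous.intervalIntegrable (by fun_prop) _ _) (D.cNU.intervalIntegrable _ _) ?_
  intro t _
  unfold BxD.NU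
  nlinarith [sq_nonneg ‖D.U t‖, sq_nonneg ‖D.V t‖, sq_nonneg ‖D.W t‖]

theorem bx_norm3' (a b c : ℂ) (l : ℝ) :
    ‖a‖ ^ 2 ≤ 3 * (‖a + b + (l : ℂ) * c‖ ^ 2 + ‖b‖ ^ 2 + l ^ 2 * ‖c‖ ^ 2) := by
  have := bx_norm3 (a + b + (l : ℂ) * c) (-b) c (-l)
  rw [norm_neg, neg_sq] at this
  refine le_trans (le_of_eq ?_) this
  congr 2
  push_cast
  ring

theorem bx_norm2' (a c : ℂ) (l : ℝ) :
    ‖a‖ ^ 2 ≤ 3 * (‖a - (l : ℂ) * c‖ ^ 2 + l ^ 2 * ‖c‖ ^ 2) := by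
  have := bx_norm2 (a - (l : ℂ) * c) c (-l)
  rw [neg_sq] at this
  refine le_trans (le_of_eq ?_) this
  congr 2
  push_cast
  ring

theorem BxD.int_G (D : BxD l κ α β L) (hb : 0 < β) (hbL : β < L) :
    (∫ t in (0:ℝ)..L, D.G t) ≤ (3 + L * (3 * (1 + l ^ 2) * Real.exp (2 * L)))
      * ∫ t in (0:ℝ)..L, D.NF t := by
  have hL : 0 ≤ L := (hb.trans hbL).le
  have cN := D.cNF
  have h : ∀ t ∈ Icc 0 L, D.G t ≤ 3 * D.NF t + 3 * (1 + l ^ 2) *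
      (Real.exp (2 * L) * ∫ t in (0:ℝ)..L, D.NF t) := by
    intro t ht
    have h1 := D.f_sup hb hbL t ht
    have h2 := bx_norm3' (D.g1 t) (D.f3 t) (D.f5 t) l
    have h3 := bx_norm2' (D.g5 t) (D.f1 t) l
    have h4 := mul_le_mul_of_nonneg_left h1 (show 0 ≤ 3 * (1 + l ^ 2) by positivity)
    refine le_trans ?_ (add_le_add_right h4 _)
    unfold BxD.NF BxD.G
    nlinarith [sq_nonneg ‖D.f2 t‖, sq_nonneg ‖D.f4 t‖, sq_nonneg ‖D.f6 t‖, sq_nonneg ‖D.g3 t‖,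
      sq_nonneg ‖D.f1 t‖, sq_nonneg ‖D.f5 t‖, sq_nonneg ‖D.f3 t‖, mul_nonneg (sq_nonneg l)
      (sq_nonneg ‖D.f3 t‖)]
  have h2 := intervalIntegral.integral_mono_on (μ := volume) hL (D.cG.intervalIntegrable _ _)
    (Continuous.intervalIntegrable (by fun_prop) _ _) h
  rw [intervalIntegral.integral_add
    (Continuous.intervalIntegrable (by fun_prop) _ _)
    (Continuous.intervalIntegrable (by fun_prop) _ _), intervalIntegral.integral_const_mul,
    intervalIntegral.integral_const] at h2
  simp only [smul_eq_mul, sub_zero] at h2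
  linarith

theorem BxD.int_E (D : BxD l κ α β L) (hb : 0 < β) (hbL : β < L) :
    (∫ t in (0:ℝ)..L, D.E t) ≤ (3 + L * ((3 * (1 + l ^ 2) + 1) * Real.exp (2 * L)))
      * ∫ t in (0:ℝ)..L, D.NU t := by
  have hL : 0 ≤ L := (hb.trans hbL).le
  have cN := D.cNU
  have h : ∀ t ∈ Icc 0 L, D.E t ≤ 3 * D.NU t + (3 * (1 + l ^ 2) + 1) *
      (Real.exp (2 * L) * ∫ t in (0:ℝ)..L, D.NU t) := by
    intro t ht
    have h1 := D.u_sup hb hbL t ht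
    have h2 := bx_norm3' (D.p t) (D.ψ t) (D.w t) l
    have h3 := bx_norm2' (D.r t) (D.u t) l
    have h4 := mul_le_mul_of_nonneg_left h1 (show 0 ≤ 3 * (1 + l ^ 2) + 1 by positivity)
    refine le_trans ?_ (add_le_add_right h4 _)
    unfold BxD.NU BxD.E
    nlinarith [sq_nonneg ‖D.U t‖, sq_nonneg ‖D.V t‖, sq_nonneg ‖D.W t‖, sq_nonneg ‖D.q t‖,
      sq_nonneg ‖D.u t‖, sq_nonneg ‖D.ψ t‖, sq_nonneg ‖D.w t‖, mul_nonneg (sq_nonneg l)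
      (sq_nonneg ‖D.ψ t‖)]
  have h2 := intervalIntegral.integral_mono_on (μ := volume) hL (D.cE.intervalIntegrable _ _)
    (Continuous.intervalIntegrable (by fun_prop) _ _) h
  rw [intervalIntegral.integral_add
    (Continuous.intervalIntegrable (by fun_prop) _ _)
    (Continuous.intervalIntegrable (by fun_prop) _ _), intervalIntegral.integral_const_mul,
    intervalIntegral.integral_const] at h2
  simp only [smul_eq_mul, sub_zero] at h2
  linarith

theorem BxD.NU_le (D : BxD l κ α β L) (t : ℝ) : D.NU t ≤ 3 * (1 + l ^ 2) * D.E t := by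
  have h2 := bx_norm3 (D.p t) (D.ψ t) (D.w t) l
  have h3 := bx_norm2 (D.r t) (D.u t) l
  unfold BxD.NU BxD.E
  have n1 := sq_nonneg ‖D.U t‖
  have n2 := sq_nonneg ‖D.p t‖
  have n3 := sq_nonneg ‖D.V t‖
  have n4 := sq_nonneg ‖D.q t‖
  have n5 := sq_nonneg ‖D.W t‖
  have n6 := sq_nonneg ‖D.r t‖
  have n7 := sq_nonneg ‖D.u t‖
  have n8 := sq_nonneg ‖D.ψ t‖
  have n9 := sq_nonneg ‖D.w t‖
  have n0 := sq_nonneg l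
  have m1 := mul_nonneg n0 n1
  have m2 := mul_nonneg n0 n2
  have m3 := mul_nonneg n0 n3
  have m4 := mul_nonneg n0 n4
  have m5 := mul_nonneg n0 n5
  have m6 := mul_nonneg n0 n6
  have m8 := mul_nonneg n0 n8
  linarith

/-- The collected uniform facts about a sequence of normalised data. -/
structure BxFacts (D : ℕ → BxD l κ α β L) : Prop where
  bu : BxBd L (fun n x => (D n).u x)
  bψ : BxBd L (fun n x => (D n).ψ x)
  bw : BxBd L (fun n x => (D n).w x)
  bp : BxBd L (fun n x => (D n).p x)
  bq : BxBd L (fun n x => (D n).q x)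
  br : BxBd L (fun n x => (D n).r x)
  bU : BxBd L (fun n x => (D n).U x)
  bV : BxBd L (fun n x => (D n).V x)
  bW : BxBd L (fun n x => (D n).W x)
  su : BxSm L (fun n x => (D n).u x)
  sψ : BxSm L (fun n x => (D n).ψ x)
  sw : BxSm L (fun n x => (D n).w x)
  wβ : Tendsto (fun n => (D n).r β * star ((D n).w β)) atTop (nhds 0)
  s1 : BxSm L (fun n x => (D n).f1 x)
  s2 : BxSm L (fun n x => (D n).f2 x)
  s3 : BxSm L (fun n x => (D n).f3 x)
  s4 : BxSm L (fun n x => (D n).f4 x)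
  s5 : BxSm L (fun n x => (D n).f5 x)
  s6 : BxSm L (fun n x => (D n).f6 x)
  t1 : BxSm L (fun n x => (D n).g1 x)
  t3 : BxSm L (fun n x => (D n).g3 x)
  t5 : BxSm L (fun n x => (D n).g5 x)
  hG : Tendsto (fun n => ∫ t in (0:ℝ)..L, (D n).G t) atTop (nhds 0)

theorem bx_small_u {lam : ℝ} (hlam : lam ≠ 0) {u U f : ℂ} {A B : ℝ}
    (h : U = Complex.I * (lam : ℂ) * u - f) (hU : ‖U‖ ≤ A) (hf : ‖f‖ ≤ B) :
    ‖u‖ ≤ (A + B) * |lam|⁻¹ := by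
  have h1 : ‖Complex.I * (lam : ℂ) * u‖ ≤ A + B := by
    have : Complex.I * (lam : ℂ) * u = U + f := by rw [h]; ring
    rw [this]
    exact (norm_add_le _ _).trans (add_le_add hU hf)
  rw [norm_mul, norm_mul, Complex.norm_I, one_mul, Complex.norm_real, Real.norm_eq_abs] at h1
  rw [← div_eq_mul_inv, le_div_iff₀ (abs_pos.2 hlam)]
  linarith

theorem bx_facts (hl : 0 < l) (hκ : 0 < κ) (hα : 0 < α) (hb : 0 < β)
    (hbL : β < L) (D : ℕ → BxD l κ α β L)
    (hlam : Tendsto (fun n => |(D n).lam|) atTop atTop) {C0 : ℝ}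
    (hN : ∀ n, (∫ t in (0:ℝ)..L, (D n).NU t) ≤ C0)
    (hF : Tendsto (fun n => ∫ t in (0:ℝ)..L, (D n).NF t) atTop (nhds 0)) : BxFacts D := by
  have hL : 0 < L := hb.trans hbL
  have hG0 : ∀ n, 0 ≤ ∫ t in (0:ℝ)..L, (D n).G t := fun n =>
    intervalIntegral.integral_nonneg hL.le fun x _ => (D n).G_nonneg x
  have hG : Tendsto (fun n => ∫ t in (0:ℝ)..L, (D n).G t) atTop (nhds 0) := by
    have := hF.const_mul (3 + L * (3 * (1 + l ^ 2) * Real.exp (2 * L)))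
    rw [mul_zero] at this
    exact squeeze_zero hG0 (fun n => (D n).int_G hb hbL) this
  obtain ⟨Γ, hΓ⟩ := hG.bddAbove_range
  have hΓ' : ∀ n, (∫ t in (0:ℝ)..L, (D n).G t) ≤ Γ := fun n => hΓ (mem_range_self n)
  obtain ⟨M, hM⟩ : ∃ M, ∀ n, ∀ x ∈ Icc 0 L, (D n).E x ≤ M := by
    refine ⟨Real.exp ((12 + 2 * l ^ 2 + l + 2 * κ + κ * l + α) * L) *
      ((3 + L * ((3 * (1 + l ^ 2) + 1) * Real.exp (2 * L))) * C0 + L * Γ) / L, fun n x hx => ?_⟩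
    have h1 := (D n).avg hl hκ hα hb hbL hL.le le_rfl (ω := fun _ => 1) continuous_const
      (fun _ _ => zero_le_one) x hx
    simp only [intervalIntegral.integral_const, smul_eq_mul, sub_zero, mul_one, one_mul] at h1
    rw [le_div_iff₀ hL, mul_comm _ L]
    refine h1.trans (mul_le_mul_of_nonneg_left (add_le_add ?_ ?_) (Real.exp_pos _).le)
    · exact ((D n).int_E hb hbL).trans (mul_le_mul_of_nonneg_left (hN n) (by positivity))
    · exact mul_le_mul_of_nonneg_left (hΓ' n) hL.le
  have bd : ∀ f : ℕ → ℝ → ℂ, (∀ n, Continuous (f n)) → (∀ n x, ‖f n x‖ ^ 2 ≤ (D n).E x) →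
      BxBd L f := fun f hf h => ⟨hf, Real.sqrt M, Real.sqrt_nonneg _, fun n x hx =>
        Real.le_sqrt_of_sq_le ((h n x).trans (hM n x hx))⟩
  have hsup : ∃ s : ℕ → ℝ, Tendsto s atTop (nhds 0) ∧ ∀ n, ∀ x ∈ Icc 0 L,
      ‖(D n).f1 x‖ ≤ s n ∧ ‖(D n).f3 x‖ ≤ s n ∧ ‖(D n).f5 x‖ ≤ s n := by
    refine ⟨fun n => Real.sqrt (Real.exp (2 * L) * ∫ t in (0:ℝ)..L, (D n).NF t), ?_, ?_⟩
    · have := (Real.continuous_sqrt.tendsto _).comp (hF.const_mul (Real.exp (2 * L)))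
      simpa [Function.comp_def] using this
    · intro n x hx
      have h := (D n).f_sup hb hbL x hx
      have n1 := sq_nonneg ‖(D n).f1 x‖
      have n3 := sq_nonneg ‖(D n).f3 x‖
      have n5 := sq_nonneg ‖(D n).f5 x‖
      refine ⟨?_, ?_, ?_⟩ <;> apply Real.le_sqrt_of_sq_le <;> linarith
  obtain ⟨s, hs, hsf⟩ := hsup
  have smG : ∀ f : ℕ → ℝ → ℂ, (∀ n, Continuous (f n)) → (∀ n x, ‖f n x‖ ^ 2 ≤ (D n).G x) →
      BxSm L f := fun f hf h => BxSm.of_sq hL.le hf (squeeze_zero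
        (fun n => intervalIntegral.integral_nonneg hL.le fun x _ => by positivity)
        (fun n => intervalIntegral.integral_mono_on hL.le
          (((hf n).norm.pow 2).intervalIntegrable _ _) ((D n).cG.intervalIntegrable _ _)
          (fun x _ => h n x)) hG)
  have hsmall : Tendsto (fun n => (Real.sqrt M + s n) * |(D n).lam|⁻¹) atTop (nhds 0) := by
    have := (hs.const_add (Real.sqrt M)).mul hlam.inv_tendsto_atTop
    simpa using this
  have hE : ∀ n, ∀ x ∈ Icc 0 L, ‖(D n).U x‖ ≤ Real.sqrt M ∧ ‖(D n).V x‖ ≤ Real.sqrt M ∧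
      ‖(D n).W x‖ ≤ Real.sqrt M ∧ ‖(D n).r x‖ ≤ Real.sqrt M := by
    intro n x hx
    have h := hM n x hx
    unfold BxD.E at h
    refine ⟨?_, ?_, ?_, ?_⟩ <;> apply Real.le_sqrt_of_sq_le <;> refine le_trans ?_ h <;>
      nlinarith [sq_nonneg ‖(D n).U x‖, sq_nonneg ‖(D n).V x‖, sq_nonneg ‖(D n).W x‖,
        sq_nonneg ‖(D n).p x‖, sq_nonneg ‖(D n).q x‖, sq_nonneg ‖(D n).r x‖,
        sq_nonneg ‖(D n).u x‖, sq_nonneg ‖(D n).ψ x‖, sq_nonneg ‖(D n).w x‖]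
  have hw : ∀ n, ∀ x ∈ Icc 0 L, ‖(D n).w x‖ ≤ (Real.sqrt M + s n) * |(D n).lam|⁻¹ :=
    fun n x hx => bx_small_u (D n).lam_ne ((D n).hW x) (hE n x hx).2.2.1 (hsf n x hx).2.2
  refine ⟨bd _ (fun n => (D n).cu) ?_, bd _ (fun n => (D n).cψ) ?_, bd _ (fun n => (D n).cw) ?_,
    bd _ (fun n => (D n).cp) ?_, bd _ (fun n => (D n).cq) ?_, bd _ (fun n => (D n).cr) ?_,
    bd _ (fun n => (D n).cU) ?_, bd _ (fun n => (D n).cV) ?_, bd _ (fun n => (D n).cW) ?_,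
    BxSm.of_sup hL.le (fun n => (D n).cu) hsmall (fun n x hx =>
      bx_small_u (D n).lam_ne ((D n).hU x) (hE n x hx).1 (hsf n x hx).1),
    BxSm.of_sup hL.le (fun n => (D n).cψ) hsmall (fun n x hx =>
      bx_small_u (D n).lam_ne ((D n).hV x) (hE n x hx).2.1 (hsf n x hx).2.1),
    BxSm.of_sup hL.le (fun n => (D n).cw) hsmall hw, ?_,
    BxSm.of_sup hL.le (fun n => (D n).cf1) hs (fun n x hx => (hsf n x hx).1),
    smG _ (fun n => (D n).cf2) ?_,
    BxSm.of_sup hL.le (fun n => (D n).cf3) hs (fun n x hx => (hsf n x hx).2.1),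
    smG _ (fun n => (D n).cf4) ?_,
    BxSm.of_sup hL.le (fun n => (D n).cf5) hs (fun n x hx => (hsf n x hx).2.2),
    smG _ (fun n => (D n).cf6) ?_,
    smG _ (fun n => (D n).cg1) ?_, smG _ (fun n => (D n).cg3) ?_, smG _ (fun n => (D n).cg5) ?_,
    hG⟩
  case refine_10 =>
    have h1 := hsmall.const_mul (Real.sqrt M)
    rw [mul_zero] at h1
    refine squeeze_zero_norm (fun n => ?_) h1
    rw [norm_mul, norm_star]
    have hβ : β ∈ Icc 0 L := ⟨hb.le, hbL.le⟩
    exact mul_le_mul (hE n β hβ).2.2.2 (hw n β hβ) (norm_nonneg _) (Real.sqrt_nonneg _)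
  case refine_11 | refine_12 | refine_13 | refine_14 | refine_15 | refine_16 =>
    intro n x
    unfold BxD.G
    nlinarith [sq_nonneg ‖(D n).g1 x‖, sq_nonneg ‖(D n).g3 x‖, sq_nonneg ‖(D n).g5 x‖,
        sq_nonneg ‖(D n).f2 x‖, sq_nonneg ‖(D n).f4 x‖, sq_nonneg ‖(D n).f6 x‖]
  all_goals
    intro n x
    unfold BxD.E
    nlinarith [sq_nonneg ‖(D n).U x‖, sq_nonneg ‖(D n).V x‖, sq_nonneg ‖(D n).W x‖,
        sq_nonneg ‖(D n).p x‖, sq_nonneg ‖(D n).q x‖, sq_nonneg ‖(D n).r x‖,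
        sq_nonneg ‖(D n).u x‖, sq_nonneg ‖(D n).ψ x‖, sq_nonneg ‖(D n).w x‖]

end BxSeq

/-! ### The multiplier steps -/

section BxSteps

variable {l κ α β L : ℝ}

/-- The complex weight `x (β - x)`. -/
def bxX (β : ℝ) (x : ℝ) : ℂ := (x : ℂ) * ((β : ℂ) - (x : ℂ))

/-- Derivative of the weight. -/
def bxY (β : ℝ) (x : ℝ) : ℂ := (β : ℂ) - 2 * (x : ℂ)

theorem bxX_cont (β : ℝ) : Continuous (bxX β) := by unfold bxX; fun_prop
theorem bxY_cont (β : ℝ) : Continuous (bxY β) := by unfold bxY; fun_prop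

theorem bxX_star (β x : ℝ) : star (bxX β x) = bxX β x := by
  simp [bxX]

theorem bxX_deriv (β x : ℝ) : HasDerivAt (bxX β) (bxY β x) x := by
  have h1 : HasDerivAt (fun y : ℝ => (y : ℂ)) 1 x := by
    simpa using (hasDerivAt_id x).ofReal_comp
  have h2 := h1.mul (h1.const_sub (β : ℂ))
  refine h2.congr_deriv ?_
  unfold bxY
  ring

theorem bxX_sq_deriv (β x : ℝ) :
    HasDerivAt (fun y => bxX β y * bxX β y) (2 * bxX β x * bxY β x) x := by
  refine ((bxX_deriv β x).mul (bxX_deriv β x)).congr_deriv ?_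
  ring

theorem bxX_zero (β : ℝ) : bxX β 0 = 0 := by simp [bxX]
theorem bxX_end (β : ℝ) : bxX β β = 0 := by simp [bxX]

theorem bx_step_W (hκ : 0 < κ) (hα : 0 < α) (hb : 0 < β)
    (hbL : β < L) (D : ℕ → BxD l κ α β L) (H : BxFacts D) :
    BxSm β (fun n x => (D n).W x) := by
  have hL : 0 ≤ L := (hb.trans hbL).le
  have hκ' : ((κ⁻¹ : ℝ) : ℂ) * (κ : ℂ) = 1 := by
    rw [← Complex.ofReal_mul, inv_mul_cancel₀ hκ.ne', Complex.ofReal_one]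
  obtain ⟨bu, bψ, bw, bp, bq, br, bU, bV, bW, su, sψ, sw, -, s1, s2, s3, s4, s5, s6, t1, t3, t5,
    -⟩ := H
  have bc : ∀ z : ℂ, BxBd L (fun _ _ => z) := fun z => BxBd.fix continuous_const
  let R0 : ℕ → ℝ → ℂ := fun n x =>
    -(star ((D n).U x) * (D n).f2 x)
    - ((D n).p x + (D n).ψ x + (l : ℂ) * (D n).w x) *
      star ((D n).g1 x + (D n).f3 x + (l : ℂ) * (D n).f5 x)
    - (((κ⁻¹ : ℝ) : ℂ) * star ((D n).V x)) * (D n).f4 x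
    - (((κ⁻¹ : ℝ) : ℂ) * (D n).q x) * star ((D n).g3 x)
    - star ((D n).W x) * (D n).f6 x
    - ((D n).r x - (l : ℂ) * (D n).u x) * star ((D n).g5 x - (l : ℂ) * (D n).f1 x)
  have hR0 : BxSm L R0 := by
    repeat' first
      | assumption
      | exact bc _
      | apply BxSm.sub hL
      | apply BxSm.add hL
      | apply BxSm.neg
      | apply BxSm.bmul hL
      | apply BxSm.star
      | apply BxBd.add
      | apply BxBd.sub
      | apply BxBd.mul
      | apply BxBd.star
  have hR : BxSm L (fun n x => R0 n x + star (R0 n x)) := hR0.add hL hR0.star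
  let Φ : ℕ → ℝ → ℂ := fun n x =>
    ((D n).p x + (D n).ψ x + (l : ℂ) * (D n).w x) * star ((D n).U x)
    + ((κ⁻¹ : ℝ) : ℂ) * ((D n).q x * star ((D n).V x))
    + ((D n).r x - (l : ℂ) * (D n).u x) * star ((D n).W x)
  have cΦ : ∀ n, Continuous (fun x => Φ n x + star (Φ n x)) := by
    intro n
    have := (D n).cu; have := (D n).cψ; have := (D n).cw; have := (D n).cp
    have := (D n).cq; have := (D n).cr
    have := (D n).cU; have := (D n).cV; have := (D n).cW
    simp only [Φ]
    fun_prop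
  have dΦ : ∀ n, ∀ x ∈ Ioo 0 β ∪ Ioo β L, HasDerivAt (fun x => Φ n x + star (Φ n x))
      (((2 * (if x < β then α else 0) : ℝ) : ℂ) * ((D n).W x * star ((D n).W x))
        + (R0 n x + star (R0 n x))) x := by
    intro n x hx
    have hxL : x ∈ Ioo 0 L := by
      rcases hx with hx | hx
      · exact ⟨hx.1, hx.2.trans hbL⟩
      · exact ⟨hb.trans hx.1, hx.2⟩
    have d1 := (((((D n).dp x hx).add ((D n).dψ x hxL)).add
      (((D n).dw x hxL).const_mul (l : ℂ))).mul ((D n).dU x hxL).star).add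
      ((((D n).dq x hx).mul ((D n).dV x hxL).star).const_mul ((κ⁻¹ : ℝ) : ℂ))
    have d2 := d1.add ((((D n).dr x hx).sub (((D n).du x hxL).const_mul (l : ℂ))).mul
      ((D n).dW x hxL).star)
    refine (d2.add d2.star).congr_deriv ?_
    generalize (if x < β then α else 0 : ℝ) = a
    simp only [R0, (D n).hU x, (D n).hV x, (D n).hW x, Pi.add_apply, Pi.sub_apply,
      Complex.star_def, map_mul, map_sub, map_add, map_neg, Complex.conj_ofReal, Complex.conj_I,
      Complex.conj_conj, Complex.ofReal_mul, Complex.ofReal_pow, Complex.ofReal_ofNat, map_pow,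
      map_ofNat]
    generalize ((κ⁻¹ : ℝ) : ℂ) = k' at hκ' ⊢
    linear_combination (((D n).p x + (D n).ψ x + (l : ℂ) * (D n).w x) *
      (-(Complex.I * (((D n).lam : ℝ) : ℂ) * (starRingEnd ℂ) ((D n).ψ x))
        - (starRingEnd ℂ) ((D n).f3 x))
      + ((starRingEnd ℂ) ((D n).p x) + (starRingEnd ℂ) ((D n).ψ x)
        + (l : ℂ) * (starRingEnd ℂ) ((D n).w x)) *
      (Complex.I * (((D n).lam : ℝ) : ℂ) * (D n).ψ x - (D n).f3 x)) * hκ'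
  have hβ : Tendsto (fun n => Φ n β + star (Φ n β)) atTop (nhds 0) := by
    refine squeeze_zero_norm (fun n => ?_) hR.2
    have c := hR.1 n
    have ftc := intervalIntegral.integral_eq_sub_of_hasDerivAt_of_le hbL.le (cΦ n).continuousOn
      (f' := fun x => R0 n x + star (R0 n x)) (fun x hx => by
        have := dΦ n x (Or.inr hx)
        rw [if_neg (not_lt.2 hx.1.le)] at this
        simpa using this) (c.intervalIntegrable _ _)
    have e : Φ n L + star (Φ n L) = 0 := by
      simp [Φ, (D n).hU, (D n).hV, (D n).hW, (D n).uL, (D n).ψL, (D n).wL, (D n).f1L, (D n).f3L,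
        (D n).f5L]
    rw [e, zero_sub] at ftc
    rw [← norm_neg, ← ftc]
    refine (intervalIntegral.norm_integral_le_integral_norm hbL.le).trans ?_
    have h1 := intervalIntegral.integral_add_adjacent_intervals
      (c.norm.intervalIntegrable (μ := volume) 0 β) (c.norm.intervalIntegrable (μ := volume) β L)
    have h2 : 0 ≤ ∫ t in (0:ℝ)..β, ‖R0 n t + star (R0 n t)‖ :=
      intervalIntegral.integral_nonneg hb.le (fun u _ => norm_nonneg _)
    linarith
  refine (bx_step (c := 2 * α) hb.le (by positivity) cΦ (fun n => (D n).cW)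
    (hR.restrict hb.le hbL.le) (fun n x hx => ?_) ?_).1
  · have := dΦ n x (Or.inl hx)
    rw [if_pos hx.2] at this
    exact this
  · refine hβ.congr (fun n => ?_)
    have e : Φ n 0 + star (Φ n 0) = 0 := by
      simp [Φ, (D n).hU, (D n).hV, (D n).hW, (D n).u0, (D n).ψ0, (D n).w0, (D n).f10, (D n).f30,
        (D n).f50]
    rw [e, sub_zero]

theorem bx_iu {lam : ℝ} {u U f : ℂ} (h : U = Complex.I * (lam : ℂ) * u - f) :
    Complex.I * (lam : ℂ) * star u = -star U - star f := by
  rw [h]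
  simp only [Complex.star_def, map_mul, map_sub, Complex.conj_ofReal, Complex.conj_I]
  ring

/-- Facts on the damped interval used by the multiplier steps. -/
theorem bx_step_all (hl : 0 < l) (hκ : 0 < κ) (hα : 0 < α) (hb : 0 < β)
    (hbL : β < L) (D : ℕ → BxD l κ α β L) (H : BxFacts D) :
    BxSm β (fun n x => (D n).W x) ∧ BxSm β (fun n x => (D n).r x) ∧
    BxSm β (fun n x => bxX β x * (D n).p x) ∧ BxSm β (fun n x => bxX β x * (D n).U x) ∧
    BxSm β (fun n x => bxX β x * (D n).q x) ∧ BxSm β (fun n x => bxX β x * (D n).V x) := by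
  have sW := bx_step_W hκ hα hb hbL D H
  have hb0 := hb.le
  have bc : ∀ z : ℂ, BxBd β (fun _ _ => z) := fun z => BxBd.fix continuous_const
  have bX : BxBd β (fun _ x => bxX β x) := BxBd.fix (bxX_cont β)
  have bY : BxBd β (fun _ x => bxY β x) := BxBd.fix (bxY_cont β)
  have bu := H.bu.restrict hbL.le
  have bψ := H.bψ.restrict hbL.le
  have bw := H.bw.restrict hbL.le
  have bp := H.bp.restrict hbL.le
  have bq := H.bq.restrict hbL.le
  have br := H.br.restrict hbL.le
  have bU := H.bU.restrict hbL.le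
  have bV := H.bV.restrict hbL.le
  have bW := H.bW.restrict hbL.le
  have su := H.su.restrict hb0 hbL.le
  have sψ := H.sψ.restrict hb0 hbL.le
  have sw := H.sw.restrict hb0 hbL.le
  have s1 := H.s1.restrict hb0 hbL.le
  have s2 := H.s2.restrict hb0 hbL.le
  have s3 := H.s3.restrict hb0 hbL.le
  have s4 := H.s4.restrict hb0 hbL.le
  have s5 := H.s5.restrict hb0 hbL.le
  have s6 := H.s6.restrict hb0 hbL.le
  have t1 := H.t1.restrict hb0 hbL.le
  have t3 := H.t3.restrict hb0 hbL.le
  have t5 := H.t5.restrict hb0 hbL.le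
  have cX := bxX_cont β
  have hin : ∀ x ∈ Ioo 0 β, x ∈ Ioo 0 L := fun x hx => ⟨hx.1, hx.2.trans hbL⟩
  -- the longitudinal strain
  have sr : BxSm β (fun n x => (D n).r x) := by
    refine (bx_step (c := 1) (Φ := fun n x => (D n).r x * star ((D n).w x))
      (R := fun n x => -((D n).W x * star ((D n).W x)) - (D n).W x * star ((D n).f5 x)
        + (((2 * l : ℝ) : ℂ) * (D n).p x + (l : ℂ) * (D n).ψ x + ((l ^ 2 : ℝ) : ℂ) * (D n).w x
          + (α : ℂ) * (D n).W x) * star ((D n).w x) - star ((D n).w x) * (D n).f6 x)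
      hb0 one_ne_zero (fun n => (D n).cr.mul (D n).cw.star) (fun n => (D n).cr) ?_ ?_ ?_).1
    · repeat' first
        | assumption
        | exact bc _
        | apply BxSm.sub hb0
        | apply BxSm.add hb0
        | apply BxSm.neg
        | apply BxSm.bmul hb0
        | apply BxSm.star
        | apply BxBd.add
        | apply BxBd.sub
        | apply BxBd.mul
        | apply BxBd.star
    · intro n x hx
      have d := ((D n).dr x (Or.inl hx)).mul ((D n).dw x (hin x hx)).star
      rw [if_pos hx.2] at d
      refine d.congr_deriv ?_
      have e := bx_iu ((D n).hW x)
      push_cast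
      linear_combination (D n).W x * e
    · refine H.wβ.congr (fun n => ?_)
      rw [(D n).w0]
      simp
  -- the transversal strain
  have sp : BxSm β (fun n x => bxX β x * (D n).p x) := by
    refine (bx_step (c := 2 * l)
      (Φ := fun n x => (bxX β x * bxX β x) * ((D n).r x * star ((D n).p x)
        + (D n).W x * star ((D n).U x)))
      (R := fun n x => (2 * bxX β x * bxY β x * star ((D n).p x)) * (D n).r x
        + (2 * bxX β x * bxY β x * star ((D n).U x)) * (D n).W x
        + (bxX β x * bxX β x * star ((D n).p x) * (l : ℂ)) * (D n).ψ x
        + (bxX β x * bxX β x * star ((D n).p x) * ((l ^ 2 : ℝ) : ℂ)) * (D n).w x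
        + (bxX β x * bxX β x * star ((D n).p x) * (α : ℂ)) * (D n).W x
        - (bxX β x * bxX β x * star ((D n).p x)) * (D n).f6 x
        + (bxX β x * bxX β x * star (((l ^ 2 : ℝ) : ℂ) * (D n).u x - (D n).q x
          - ((2 * l : ℝ) : ℂ) * (D n).r x)) * (D n).r x
        - (bxX β x * bxX β x * (D n).r x) * star ((D n).f2 x)
        - (bxX β x * bxX β x * star ((D n).U x)) * (D n).g5 x
        - (bxX β x * bxX β x * (D n).W x) * star ((D n).g1 x))
      hb0 (by positivity) (fun n => (cX.mul cX).mul (((D n).cr.mul (D n).cp.star).add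
        ((D n).cW.mul (D n).cU.star))) (fun n => cX.mul (D n).cp) ?_ ?_ ?_).1
    · repeat' first
        | assumption
        | exact bc _
        | apply BxSm.sub hb0
        | apply BxSm.add hb0
        | apply BxSm.neg
        | apply BxSm.bmul hb0
        | apply BxSm.star
        | apply BxBd.add
        | apply BxBd.sub
        | apply BxBd.mul
        | apply BxBd.star
    · intro n x hx
      have d := (bxX_sq_deriv β x).mul
        ((((D n).dr x (Or.inl hx)).mul ((D n).dp x (Or.inl hx)).star).add
          (((D n).dW x (hin x hx)).mul ((D n).dU x (hin x hx)).star))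
      rw [if_pos hx.2] at d
      refine d.congr_deriv ?_
      have e := bxX_star β x
      simp only [Complex.star_def] at e
      simp only [Pi.add_apply, Pi.mul_apply,
        Complex.star_def, map_mul, map_sub, map_add, map_neg, Complex.conj_ofReal, Complex.conj_I,
        e]
      push_cast
      ring
    · refine tendsto_const_nhds.congr (fun n => ?_)
      rw [bxX_zero, bxX_end]
      simp
  have sU : BxSm β (fun n x => bxX β x * (D n).U x) := by
    refine (bx_step (c := -1)
      (Φ := fun n x => (bxX β x * bxX β x) * ((D n).p x * star ((D n).u x)))
      (R := fun n x => (2 * bxX β x * bxY β x * (D n).p x) * star ((D n).u x)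
        + (bxX β x * bxX β x * (((l ^ 2 : ℝ) : ℂ) * (D n).u x - (D n).q x
          - ((2 * l : ℝ) : ℂ) * (D n).r x)) * star ((D n).u x)
        - (bxX β x * bxX β x * star ((D n).u x)) * (D n).f2 x
        - (bxX β x * bxX β x * (D n).U x) * star ((D n).f1 x)
        + (bxX β x * star ((D n).p x)) * (bxX β x * (D n).p x))
      hb0 (by norm_num) (fun n => (cX.mul cX).mul ((D n).cp.mul (D n).cu.star))
      (fun n => cX.mul (D n).cU) ?_ ?_ ?_).1
    · repeat' first
        | assumption
        | exact bc _
        | apply BxSm.sub hb0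
        | apply BxSm.add hb0
        | apply BxSm.neg
        | apply BxSm.bmul hb0
        | apply BxSm.star
        | apply BxBd.add
        | apply BxBd.sub
        | apply BxBd.mul
        | apply BxBd.star
    · intro n x hx
      have d := (bxX_sq_deriv β x).mul
        (((D n).dp x (Or.inl hx)).mul ((D n).du x (hin x hx)).star)
      refine d.congr_deriv ?_
      have e := bxX_star β x
      have e2 := bx_iu ((D n).hU x)
      simp only [Complex.star_def] at e e2
      simp only [Pi.add_apply, Pi.mul_apply,
        Complex.star_def, map_mul, map_sub, map_add, map_neg, Complex.conj_ofReal, Complex.conj_I,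
        e]
      push_cast
      linear_combination (bxX β x * bxX β x * (D n).U x) * e2
    · refine tendsto_const_nhds.congr (fun n => ?_)
      rw [bxX_zero, bxX_end]
      simp
  -- the rotation
  have sq : BxSm β (fun n x => bxX β x * (D n).q x) := by
    refine (bx_step (c := -1)
      (Φ := fun n x => (bxX β x * bxX β x) * ((D n).p x * star ((D n).q x)
        + (D n).U x * star ((D n).V x)))
      (R := fun n x => (2 * bxY β x * star ((D n).q x)) * (bxX β x * (D n).p x)
        + (2 * bxY β x * star ((D n).V x)) * (bxX β x * (D n).U x)
        - (bxX β x * bxX β x * star ((D n).q x) * ((2 * l : ℝ) : ℂ)) * (D n).r x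
        + (bxX β x * bxX β x * star ((D n).q x) * ((l ^ 2 : ℝ) : ℂ)) * (D n).u x
        - (bxX β x * bxX β x * star ((D n).q x)) * (D n).f2 x
        + (bxX β x * (κ : ℂ) * star ((D n).p x + (D n).ψ x + (l : ℂ) * (D n).w x))
          * (bxX β x * (D n).p x)
        - (bxX β x * bxX β x * (D n).p x) * star ((D n).f4 x)
        - (bxX β x * bxX β x * star ((D n).V x)) * (D n).g1 x
        - (bxX β x * bxX β x * (D n).U x) * star ((D n).g3 x))
      hb0 (by norm_num) (fun n => (cX.mul cX).mul (((D n).cp.mul (D n).cq.star).add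
        ((D n).cU.mul (D n).cV.star))) (fun n => cX.mul (D n).cq) ?_ ?_ ?_).1
    · repeat' first
        | assumption
        | exact bc _
        | apply BxSm.sub hb0
        | apply BxSm.add hb0
        | apply BxSm.neg
        | apply BxSm.bmul hb0
        | apply BxSm.star
        | apply BxBd.add
        | apply BxBd.sub
        | apply BxBd.mul
        | apply BxBd.star
    · intro n x hx
      have d := (bxX_sq_deriv β x).mul
        ((((D n).dp x (Or.inl hx)).mul ((D n).dq x (Or.inl hx)).star).add
          (((D n).dU x (hin x hx)).mul ((D n).dV x (hin x hx)).star))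
      refine d.congr_deriv ?_
      have e := bxX_star β x
      simp only [Complex.star_def] at e
      simp only [Pi.add_apply, Pi.mul_apply,
        Complex.star_def, map_mul, map_sub, map_add, map_neg, Complex.conj_ofReal, Complex.conj_I,
        e]
      push_cast
      ring
    · refine tendsto_const_nhds.congr (fun n => ?_)
      rw [bxX_zero, bxX_end]
      simp
  have sV : BxSm β (fun n x => bxX β x * (D n).V x) := by
    refine (bx_step (c := -1)
      (Φ := fun n x => (bxX β x * bxX β x) * ((D n).q x * star ((D n).ψ x)))
      (R := fun n x => (2 * bxX β x * bxY β x * (D n).q x) * star ((D n).ψ x)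
        + (bxX β x * bxX β x * ((κ : ℂ) * ((D n).p x + (D n).ψ x + (l : ℂ) * (D n).w x)))
          * star ((D n).ψ x)
        - (bxX β x * bxX β x * star ((D n).ψ x)) * (D n).f4 x
        - (bxX β x * bxX β x * (D n).V x) * star ((D n).f3 x)
        + (bxX β x * star ((D n).q x)) * (bxX β x * (D n).q x))
      hb0 (by norm_num) (fun n => (cX.mul cX).mul ((D n).cq.mul (D n).cψ.star))
      (fun n => cX.mul (D n).cV) ?_ ?_ ?_).1
    · repeat' first
        | assumption
        | exact bc _
        | apply BxSm.sub hb0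
        | apply BxSm.add hb0
        | apply BxSm.neg
        | apply BxSm.bmul hb0
        | apply BxSm.star
        | apply BxBd.add
        | apply BxBd.sub
        | apply BxBd.mul
        | apply BxBd.star
    · intro n x hx
      have d := (bxX_sq_deriv β x).mul
        (((D n).dq x (Or.inl hx)).mul ((D n).dψ x (hin x hx)).star)
      refine d.congr_deriv ?_
      have e := bxX_star β x
      have e2 := bx_iu ((D n).hV x)
      simp only [Complex.star_def] at e e2
      simp only [Pi.add_apply, Pi.mul_apply,
        Complex.star_def, map_mul, map_sub, map_add, map_neg, Complex.conj_ofReal, Complex.conj_I,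
        e]
      push_cast
      linear_combination (bxX β x * bxX β x * (D n).V x) * e2
    · refine tendsto_const_nhds.congr (fun n => ?_)
      rw [bxX_zero, bxX_end]
      simp
  exact ⟨sW, sr, sp, sU, sq, sV⟩

end BxSteps

/-! ### Conclusion for the normalised system -/

section BxConcl

variable {l κ α β L : ℝ}

theorem bx_sq_small {b : ℝ} (hb : 0 ≤ b) {f : ℕ → ℝ → ℂ} {X : ℝ → ℂ} {ω : ℝ → ℝ}
    (hX : Continuous X) (hω : ∀ x, ω x = ‖X x‖ ^ 2) (bf : BxBd b f)
    (sf : BxSm b (fun n x => X x * f n x)) :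
    Tendsto (fun n => ∫ x in (0:ℝ)..b, ω x * ‖f n x‖ ^ 2) atTop (nhds 0) := by
  have h := (BxSm.bmul hb ((BxBd.fix (b := b) hX).mul bf) sf).2
  refine h.congr (fun n => ?_)
  refine intervalIntegral.integral_congr (fun x _ => ?_)
  simp only [norm_mul, hω]
  ring

theorem bx_concl (hl : 0 < l) (hκ : 0 < κ) (hα : 0 < α) (hb : 0 < β)
    (hbL : β < L) (D : ℕ → BxD l κ α β L)
    (hlam : Tendsto (fun n => |(D n).lam|) atTop atTop) {C0 : ℝ}
    (hN : ∀ n, (∫ t in (0:ℝ)..L, (D n).NU t) ≤ C0)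
    (hF : Tendsto (fun n => ∫ t in (0:ℝ)..L, (D n).NF t) atTop (nhds 0)) :
    Tendsto (fun n => ∫ t in (0:ℝ)..L, (D n).NU t) atTop (nhds 0) := by
  have hL : 0 < L := hb.trans hbL
  have H := bx_facts hl hκ hα hb hbL D hlam hN hF
  obtain ⟨sW, sr, sp, sU, sq, sV⟩ := bx_step_all hl hκ hα hb hbL D H
  have hb0 := hb.le
  have bX : BxBd β (fun _ x => bxX β x) := BxBd.fix (bxX_cont β)
  have cX := bxX_cont β
  let ω : ℝ → ℝ := fun x => ‖bxX β x‖ ^ 2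
  have cω : Continuous ω := by simp only [ω]; fun_prop
  have eω : ∀ x, ω x = ‖bxX β x‖ ^ 2 := fun x => rfl
  have a1 := bx_sq_small hb0 cX eω (H.bU.restrict hbL.le) sU
  have a2 := bx_sq_small hb0 cX eω (H.bp.restrict hbL.le) sp
  have a3 := bx_sq_small hb0 cX eω (H.bV.restrict hbL.le) sV
  have a4 := bx_sq_small hb0 cX eω (H.bq.restrict hbL.le) sq
  have a5 := bx_sq_small hb0 cX eω (H.bW.restrict hbL.le) (BxSm.bmul hb0 bX sW)
  have a6 := bx_sq_small hb0 cX eω (H.br.restrict hbL.le) (BxSm.bmul hb0 bX sr)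
  have a7 := bx_sq_small hb0 cX eω (H.bu.restrict hbL.le)
    (BxSm.bmul hb0 bX (H.su.restrict hb0 hbL.le))
  have a8 := bx_sq_small hb0 cX eω (H.bψ.restrict hbL.le)
    (BxSm.bmul hb0 bX (H.sψ.restrict hb0 hbL.le))
  have a9 := bx_sq_small hb0 cX eω (H.bw.restrict hbL.le)
    (BxSm.bmul hb0 bX (H.sw.restrict hb0 hbL.le))
  have aE : Tendsto (fun n => ∫ x in (0:ℝ)..β, ω x * (D n).E x) atTop (nhds 0) := by
    have := (((a1.add a2).add (a3.add a4)).add (a5.add a6)).add ((a7.add a8).add a9)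
    simp only [add_zero] at this
    refine this.congr (fun n => ?_)
    have := (D n).cu; have := (D n).cψ; have := (D n).cw; have := (D n).cp
    have := (D n).cq; have := (D n).cr
    have := (D n).cU; have := (D n).cV; have := (D n).cW
    simp only [BxD.E, mul_add]
    repeat rw [intervalIntegral.integral_add]
    all_goals exact Continuous.intervalIntegrable (by fun_prop) _ _
  have J0 : 0 < ∫ y in (0:ℝ)..β, ω y := by
    refine intervalIntegral.intervalIntegral_pos_of_pos_on (cω.intervalIntegrable _ _)
      (fun x hx => ?_) hb
    have h1 : bxX β x ≠ 0 := by
      unfold bxX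
      refine mul_ne_zero ?_ ?_
      · exact_mod_cast hx.1.ne'
      · rw [← Complex.ofReal_sub]
        exact_mod_cast (sub_pos.2 hx.2).ne'
    have := norm_pos_iff.2 h1
    simp only [ω]
    positivity
  set J := ∫ y in (0:ℝ)..β, ω y with hJ
  set K := Real.exp ((12 + 2 * l ^ 2 + l + 2 * κ + κ * l + α) * L) with hK
  have lim : Tendsto (fun n => L * (3 * (1 + l ^ 2) * (K * ((∫ x in (0:ℝ)..β, ω x * (D n).E x)
      + J * ∫ t in (0:ℝ)..L, (D n).G t) / J))) atTop (nhds 0) := by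
    have := ((((aE.add (H.hG.const_mul J)).const_mul K).div_const J).const_mul
      (3 * (1 + l ^ 2))).const_mul L
    simpa using this
  refine squeeze_zero (fun n => intervalIntegral.integral_nonneg hL.le
    fun x _ => (D n).NU_nonneg x) (fun n => ?_) lim
  have h := intervalIntegral.integral_mono_on (μ := volume) hL.le
    ((D n).cNU.intervalIntegrable _ _) (continuous_const.intervalIntegrable 0 L)
    (g := fun _ => (3 * (1 + l ^ 2) * (K * ((∫ x in (0:ℝ)..β, ω x * (D n).E x)
      + J * ∫ t in (0:ℝ)..L, (D n).G t) / J))) (fun x hx => by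
      refine ((D n).NU_le x).trans (mul_le_mul_of_nonneg_left ?_ (by positivity))
      rw [le_div_iff₀ J0, mul_comm _ J]
      exact (D n).avg hl hκ hα hb hbL hb0 hbL.le cω (fun y _ => by simp only [ω]; positivity) x hx)
  rw [intervalIntegral.integral_const, smul_eq_mul, sub_zero] at h
  exact h

end BxConcl

/-! ### Extension to the whole line and conversion -/

section BxConv

/-- Extension by constants outside `[0,L]`. -/
def bxE (L : ℝ) (f : ℝ → ℂ) (x : ℝ) : ℂ := f (max 0 (min L x))

theorem bxE_eq {L : ℝ} {f : ℝ → ℂ} {x : ℝ} (hx : x ∈ Icc 0 L) : bxE L f x = f x := by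
  unfold bxE
  rw [min_eq_right hx.2, max_eq_right hx.1]

theorem bxE_cont {L : ℝ} (hL : 0 < L) {f : ℝ → ℂ} (hf : ContinuousOn f (Icc 0 L)) :
    Continuous (bxE L f) := by
  refine hf.comp_continuous (by fun_prop) (fun x => ?_)
  exact ⟨le_max_left _ _, max_le hL.le (min_le_left _ _)⟩

theorem bxE_ev {L : ℝ} {f : ℝ → ℂ} {x : ℝ} (hx : x ∈ Ioo 0 L) : bxE L f =ᶠ[nhds x] f := by
  filter_upwards [isOpen_Ioo.mem_nhds hx] with y hy
  exact bxE_eq (Ioo_subset_Icc_self hy)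

/-- The extended derivative. -/
def bxP (L : ℝ) (f : ℝ → ℂ) : ℝ → ℂ := bxE L (derivWithin f (Icc 0 L))

theorem bxP_eq {L : ℝ} {f : ℝ → ℂ} {x : ℝ} (hx : x ∈ Ioo 0 L) : bxP L f x = deriv f x := by
  unfold bxP
  rw [bxE_eq (Ioo_subset_Icc_self hx), derivWithin_of_mem_nhds (Icc_mem_nhds hx.1 hx.2)]

theorem bxP_ev {L : ℝ} {f : ℝ → ℂ} {x : ℝ} (hx : x ∈ Ioo 0 L) : bxP L f =ᶠ[nhds x] deriv f := by
  filter_upwards [isOpen_Ioo.mem_nhds hx] with y hy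
  exact bxP_eq hy

theorem bxP_cont {L : ℝ} (hL : 0 < L) {f : ℝ → ℂ} (hf : ContDiffOn ℝ 1 f (Icc 0 L)) :
    Continuous (bxP L f) :=
  bxE_cont hL (hf.continuousOn_derivWithin (uniqueDiffOn_Icc hL) le_rfl)

theorem bx_hasDeriv {a b : ℝ} {f : ℝ → ℂ} (hf : ContDiffOn ℝ 1 f (Icc a b)) {x : ℝ}
    (hx : x ∈ Ioo a b) : HasDerivAt f (deriv f x) x :=
  ((hf.differentiableOn one_ne_zero).differentiableAt (Icc_mem_nhds hx.1 hx.2)).hasDerivAt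

theorem bxE_deriv {L : ℝ} {f : ℝ → ℂ} (hf : ContDiffOn ℝ 1 f (Icc 0 L)) {x : ℝ}
    (hx : x ∈ Ioo 0 L) : HasDerivAt (bxE L f) (bxP L f x) x := by
  rw [bxP_eq hx]
  exact (bx_hasDeriv hf hx).congr_of_eventuallyEq (bxE_ev hx)

theorem bx_hasDeriv2 {a b : ℝ} {f : ℝ → ℂ} (hf : ContDiffOn ℝ 2 f (Icc a b)) {x : ℝ}
    (hx : x ∈ Ioo a b) : HasDerivAt (deriv f) (deriv (deriv f) x) x := by
  have h1 : ContDiffOn ℝ 2 f (Ioo a b) := hf.mono Ioo_subset_Icc_self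
  have h2 : ContDiffOn ℝ 1 (deriv f) (Ioo a b) := h1.deriv_of_isOpen isOpen_Ioo (by norm_num)
  exact ((h2.differentiableOn one_ne_zero).differentiableAt
    (isOpen_Ioo.mem_nhds hx)).hasDerivAt

theorem bxP_deriv {L a b : ℝ} {f : ℝ → ℂ} (hf : ContDiffOn ℝ 2 f (Icc a b)) {x : ℝ}
    (hx : x ∈ Ioo a b) (hx' : x ∈ Ioo 0 L) : HasDerivAt (bxP L f) (deriv (deriv f) x) x :=
  (bx_hasDeriv2 hf hx).congr_of_eventuallyEq (bxP_ev hx')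

variable {ρ₁ ρ₂ k₁ k₂ l L β a₀ : ℝ}

theorem bx_mem (hb : 0 < β) (hbL : β < L) {x : ℝ} (hx : x ∈ Ioo 0 β ∪ Ioo β L) :
    x ∈ Ioo 0 L := by
  rcases hx with hx | hx
  · exact ⟨hx.1, hx.2.trans hbL⟩
  · exact ⟨hb.trans hx.1, hx.2⟩

theorem bx_v5 (S : BresseSetting ρ₁ ρ₂ k₁ k₂ k₁ l L β a₀ 0) (n : ℕ) {x : ℝ}
    (hx : x ∈ Ioo 0 β ∪ Ioo β L) (hx' : x ∈ Ioo 0 L) :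
    HasDerivAt (bxP L (S.v5 n)) (deriv (deriv (S.v5 n)) x) x ∧
    HasDerivAt (deriv (S.v5 n)) (deriv (deriv (S.v5 n)) x) x := by
  rcases hx with hx | hx
  · exact ⟨bxP_deriv (S.reg_v5_left n) hx hx', bx_hasDeriv2 (S.reg_v5_left n) hx⟩
  · exact ⟨bxP_deriv (S.reg_v5_right n) hx hx', bx_hasDeriv2 (S.reg_v5_right n) hx⟩

/-- Normalised data attached to a member of the resolvent sequence. -/
def bxMk (S : BresseSetting ρ₁ ρ₂ k₁ k₂ k₁ l L β a₀ 0) {s : ℝ} (hs : 0 < s)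
    (h1 : s ^ 2 * k₁ = ρ₁) (h2 : s ^ 2 * k₂ = ρ₂) (hk1 : 0 < k₁) (hk2 : 0 < k₂)
    (hb : 0 < β) (hbL : β < L) (n : ℕ) : BxD l (k₁ / k₂) (a₀ / (k₁ * s)) β L where
  lam := s * S.lam n
  u := bxE L (S.v1 n)
  ψ := bxE L (S.v3 n)
  w := bxE L (S.v5 n)
  p := bxP L (S.v1 n)
  q := bxP L (S.v3 n)
  r := bxP L (S.v5 n)
  U := fun x => (s : ℂ) * (Complex.I * (S.lam n : ℂ) * bxE L (S.v1 n) x - bxE L (S.f1 n) x)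
  V := fun x => (s : ℂ) * (Complex.I * (S.lam n : ℂ) * bxE L (S.v3 n) x - bxE L (S.f3 n) x)
  W := fun x => (s : ℂ) * (Complex.I * (S.lam n : ℂ) * bxE L (S.v5 n) x - bxE L (S.f5 n) x)
  f1 := fun x => (s : ℂ) * bxE L (S.f1 n) x
  f2 := fun x => (s : ℂ) ^ 2 * bxE L (S.f2 n) x
  f3 := fun x => (s : ℂ) * bxE L (S.f3 n) x
  f4 := fun x => (s : ℂ) ^ 2 * bxE L (S.f4 n) x
  f5 := fun x => (s : ℂ) * bxE L (S.f5 n) x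
  f6 := fun x => (s : ℂ) ^ 2 * bxE L (S.f6 n) x
  g1 := fun x => (s : ℂ) * bxP L (S.f1 n) x
  g3 := fun x => (s : ℂ) * bxP L (S.f3 n) x
  g5 := fun x => (s : ℂ) * bxP L (S.f5 n) x
  cu := bxE_cont (hb.trans hbL) (S.reg_v1 n).continuousOn
  cψ := bxE_cont (hb.trans hbL) (S.reg_v3 n).continuousOn
  cw := bxE_cont (hb.trans hbL) (S.reg_v5 n).continuousOn
  cp := bxP_cont (hb.trans hbL) ((S.reg_v1 n).of_le (by norm_num))
  cq := bxP_cont (hb.trans hbL) ((S.reg_v3 n).of_le (by norm_num))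
  cr := bxP_cont (hb.trans hbL) (S.reg_v5 n)
  cf1 := continuous_const.mul (bxE_cont (hb.trans hbL) (S.reg_f1 n).continuousOn)
  cf2 := continuous_const.mul (bxE_cont (hb.trans hbL) (S.reg_f2 n))
  cf3 := continuous_const.mul (bxE_cont (hb.trans hbL) (S.reg_f3 n).continuousOn)
  cf4 := continuous_const.mul (bxE_cont (hb.trans hbL) (S.reg_f4 n))
  cf5 := continuous_const.mul (bxE_cont (hb.trans hbL) (S.reg_f5 n).continuousOn)
  cf6 := continuous_const.mul (bxE_cont (hb.trans hbL) (S.reg_f6 n))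
  cg1 := continuous_const.mul (bxP_cont (hb.trans hbL) (S.reg_f1 n))
  cg3 := continuous_const.mul (bxP_cont (hb.trans hbL) (S.reg_f3 n))
  cg5 := continuous_const.mul (bxP_cont (hb.trans hbL) (S.reg_f5 n))
  lam_ne := mul_ne_zero hs.ne' (S.lam_ne n)
  hU := fun x => by push_cast; ring
  hV := fun x => by push_cast; ring
  hW := fun x => by push_cast; ring
  du := fun x hx => bxE_deriv ((S.reg_v1 n).of_le (by norm_num)) hx
  dψ := fun x hx => bxE_deriv ((S.reg_v3 n).of_le (by norm_num)) hx
  dw := fun x hx => bxE_deriv (S.reg_v5 n) hx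
  df1 := fun x hx => (bxE_deriv (S.reg_f1 n) hx).const_mul _
  df3 := fun x hx => (bxE_deriv (S.reg_f3 n) hx).const_mul _
  df5 := fun x hx => (bxE_deriv (S.reg_f5 n) hx).const_mul _
  dp := fun x hx => by
    have hx' := bx_mem hb hbL hx
    have hx2 := Ioo_subset_Icc_self hx'
    refine (bxP_deriv (S.reg_v1 n) hx' hx').congr_deriv ?_
    rw [bxP_eq hx', bxP_eq hx', bxE_eq hx2, bxE_eq hx2, bxE_eq hx2]
    have e1 := S.eq1 n x hx
    have e2 := S.eq2 n x hx
    have d : HasDerivAt (fun y => deriv (S.v1 n) y + S.v3 n y + (l : ℂ) * S.v5 n y)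
        (deriv (deriv (S.v1 n)) x + deriv (S.v3 n) x + (l : ℂ) * deriv (S.v5 n) x) x :=
      ((bx_hasDeriv2 (S.reg_v1 n) hx').add
        (bx_hasDeriv ((S.reg_v3 n).of_le (by norm_num)) hx')).add
        ((bx_hasDeriv (S.reg_v5 n) hx').const_mul _)
    rw [d.deriv] at e2
    simp only [Nat.cast_zero, neg_zero, zpow_zero, one_mul, mul_one] at e1 e2
    have hk : (k₁ : ℂ) ≠ 0 := by exact_mod_cast hk1.ne'
    have hr : (ρ₁ : ℂ) = (s : ℂ) ^ 2 * (k₁ : ℂ) := by rw [← h1]; push_cast; ring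
    rw [hr] at e2
    apply mul_left_cancel₀ hk
    push_cast
    linear_combination -e2 - Complex.I * (S.lam n : ℂ) * (s : ℂ) ^ 2 * (k₁ : ℂ) * e1
  dq := fun x hx => by
    have hx' := bx_mem hb hbL hx
    have hx2 := Ioo_subset_Icc_self hx'
    refine (bxP_deriv (S.reg_v3 n) hx' hx').congr_deriv ?_
    rw [bxP_eq hx', bxE_eq hx2, bxE_eq hx2, bxE_eq hx2, bxE_eq hx2]
    have e1 := S.eq3 n x hx
    have e2 := S.eq4 n x hx
    simp only [Nat.cast_zero, neg_zero, zpow_zero, one_mul, mul_one] at e1 e2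
    have hk : (k₂ : ℂ) ≠ 0 := by exact_mod_cast hk2.ne'
    have hr : (ρ₂ : ℂ) = (s : ℂ) ^ 2 * (k₂ : ℂ) := by rw [← h2]; push_cast; ring
    rw [hr] at e2
    have hd : (k₂ : ℂ) * ((k₁ / k₂ : ℝ) : ℂ) = (k₁ : ℂ) := by
      rw [← Complex.ofReal_mul, mul_div_cancel₀ _ hk2.ne']
    apply mul_left_cancel₀ hk
    rw [Complex.ofReal_mul]
    linear_combination -e2 - Complex.I * (S.lam n : ℂ) * (s : ℂ) ^ 2 * (k₂ : ℂ) * e1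
      - (deriv (S.v1 n) x + S.v3 n x + (l : ℂ) * S.v5 n x) * hd
  dr := fun x hx => by
    have hx' := bx_mem hb hbL hx
    have hx2 := Ioo_subset_Icc_self hx'
    have d2 := bx_v5 S n hx hx'
    refine d2.1.congr_deriv ?_
    rw [bxP_eq hx', bxE_eq hx2, bxE_eq hx2, bxE_eq hx2, bxE_eq hx2]
    have e1 := S.eq5 n x hx
    have e2 := S.eq6 n x hx
    have d : HasDerivAt (fun y => deriv (S.v5 n) y - (l : ℂ) * S.v1 n y)
        (deriv (deriv (S.v5 n)) x - (l : ℂ) * deriv (S.v1 n) x) x :=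
      d2.2.sub ((bx_hasDeriv ((S.reg_v1 n).of_le (by norm_num)) hx').const_mul _)
    rw [d.deriv] at e2
    simp only [Nat.cast_zero, neg_zero, zpow_zero, one_mul, mul_one] at e1 e2
    have hk : (k₁ : ℂ) ≠ 0 := by exact_mod_cast hk1.ne'
    have hr : (ρ₁ : ℂ) = (s : ℂ) ^ 2 * (k₁ : ℂ) := by rw [← h1]; push_cast; ring
    have hd : ((if x < β then a₀ / (k₁ * s) else 0 : ℝ) : ℂ) * ((k₁ : ℂ) * (s : ℂ))
        = (if x < β then (a₀ : ℂ) else 0) := by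
      split_ifs
      · rw [← Complex.ofReal_mul, ← Complex.ofReal_mul, div_mul_cancel₀ _ (by positivity)]
      · simp
    rw [hr, ← hd] at e2
    generalize ((if x < β then a₀ / (k₁ * s) else 0 : ℝ) : ℂ) = A at e2 ⊢
    apply mul_left_cancel₀ hk
    push_cast
    linear_combination -e2 - (Complex.I * (S.lam n : ℂ) * (s : ℂ) ^ 2 * (k₁ : ℂ)
      + A * (k₁ : ℂ) * (s : ℂ)) * e1
  u0 := by rw [bxE_eq ⟨le_rfl, (hb.trans hbL).le⟩]; exact (S.bc_zero n).1
  ψ0 := by rw [bxE_eq ⟨le_rfl, (hb.trans hbL).le⟩]; exact (S.bc_zero n).2.2.1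
  w0 := by rw [bxE_eq ⟨le_rfl, (hb.trans hbL).le⟩]; exact (S.bc_zero n).2.2.2.2.1
  f10 := by rw [bxE_eq ⟨le_rfl, (hb.trans hbL).le⟩, (S.bc_zero n).2.2.2.2.2.2.1, mul_zero]
  f30 := by rw [bxE_eq ⟨le_rfl, (hb.trans hbL).le⟩, (S.bc_zero n).2.2.2.2.2.2.2.1, mul_zero]
  f50 := by rw [bxE_eq ⟨le_rfl, (hb.trans hbL).le⟩, (S.bc_zero n).2.2.2.2.2.2.2.2, mul_zero]
  uL := by rw [bxE_eq ⟨(hb.trans hbL).le, le_rfl⟩]; exact (S.bc_L n).1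
  ψL := by rw [bxE_eq ⟨(hb.trans hbL).le, le_rfl⟩]; exact (S.bc_L n).2.2.1
  wL := by rw [bxE_eq ⟨(hb.trans hbL).le, le_rfl⟩]; exact (S.bc_L n).2.2.2.2.1
  f1L := by rw [bxE_eq ⟨(hb.trans hbL).le, le_rfl⟩, (S.bc_L n).2.2.2.2.2.2.1, mul_zero]
  f3L := by rw [bxE_eq ⟨(hb.trans hbL).le, le_rfl⟩, (S.bc_L n).2.2.2.2.2.2.2.1, mul_zero]
  f5L := by rw [bxE_eq ⟨(hb.trans hbL).le, le_rfl⟩, (S.bc_L n).2.2.2.2.2.2.2.2, mul_zero]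

theorem bx_int_congr (hb : 0 < β) (hbL : β < L) {f g : ℝ → ℝ}
    (h : ∀ x ∈ Ioo 0 β ∪ Ioo β L, f x = g x) :
    (∫ x in (0:ℝ)..L, f x) = ∫ x in (0:ℝ)..L, g x := by
  refine intervalIntegral.integral_congr_ae ?_
  have e1 : ∀ᵐ x : ℝ, x ≠ β := by simp [ae_iff]
  have e2 : ∀ᵐ x : ℝ, x ≠ L := by simp [ae_iff]
  filter_upwards [e1, e2] with x h1 h2 hx
  rw [uIoc_of_le (hb.trans hbL).le] at hx
  apply h
  rcases lt_or_gt_of_ne h1 with h3 | h3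
  · exact Or.inl ⟨hx.1, h3⟩
  · exact Or.inr ⟨h3, lt_of_le_of_ne hx.2 h2⟩

theorem bx_nsq (s : ℝ) (z : ℂ) : ‖(s : ℂ) * z‖ ^ 2 = s ^ 2 * ‖z‖ ^ 2 := by
  rw [norm_mul, mul_pow, Complex.norm_real, Real.norm_eq_abs, sq_abs]

theorem bx_final (S : BresseSetting ρ₁ ρ₂ k₁ k₂ k₁ l L β a₀ 0) {s : ℝ} (hs : 0 < s)
    (h1 : s ^ 2 * k₁ = ρ₁) (h2 : s ^ 2 * k₂ = ρ₂) (hk1 : 0 < k₁) (hk2 : 0 < k₂)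
    (hl : 0 < l) (ha : 0 < a₀) (hb : 0 < β) (hbL : β < L) : False := by
  have hL : 0 < L := hb.trans hbL
  let D : ℕ → BxD l (k₁ / k₂) (a₀ / (k₁ * s)) β L := bxMk S hs h1 h2 hk1 hk2 hb hbL
  -- weighted energies
  let A : ℕ → ℝ → ℝ := fun n x =>
    k₁ * ‖(D n).p x + (D n).ψ x + (l : ℂ) * (D n).w x‖ ^ 2 + k₁ * ‖(D n).U x‖ ^ 2
      + k₂ * ‖(D n).q x‖ ^ 2 + k₂ * ‖(D n).V x‖ ^ 2
      + k₁ * ‖(D n).r x - (l : ℂ) * (D n).u x‖ ^ 2 + k₁ * ‖(D n).W x‖ ^ 2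
  let B : ℕ → ℝ → ℝ := fun n x =>
    k₁ * ‖(D n).g1 x + (D n).f3 x + (l : ℂ) * (D n).f5 x‖ ^ 2 + k₁ * ‖(D n).f2 x‖ ^ 2
      + k₂ * ‖(D n).g3 x‖ ^ 2 + k₂ * ‖(D n).f4 x‖ ^ 2
      + k₁ * ‖(D n).g5 x - (l : ℂ) * (D n).f1 x‖ ^ 2 + k₁ * ‖(D n).f6 x‖ ^ 2
  have cA : ∀ n, Continuous (A n) := by
    intro n
    have := (D n).cu; have := (D n).cψ; have := (D n).cw; have := (D n).cp
    have := (D n).cq; have := (D n).cr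
    have := (D n).cU; have := (D n).cV; have := (D n).cW
    simp only [A]
    fun_prop
  have cB : ∀ n, Continuous (B n) := by
    intro n
    have := (D n).cf1; have := (D n).cf2; have := (D n).cf3; have := (D n).cf4
    have := (D n).cf5; have := (D n).cf6
    have := (D n).cg1; have := (D n).cg3; have := (D n).cg5
    simp only [B]
    fun_prop
  have iA : ∀ n, (∫ x in (0:ℝ)..L, A n x) = 1 := by
    intro n
    rw [← S.normU n]
    refine bx_int_congr hb hbL (fun x hx => ?_)
    have hx' := bx_mem hb hbL hx
    have hx2 := Ioo_subset_Icc_self hx'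
    have e1 := S.eq1 n x hx
    have e3 := S.eq3 n x hx
    have e5 := S.eq5 n x hx
    simp only [Nat.cast_zero, neg_zero, zpow_zero, one_mul] at e1 e3 e5
    have e1' : Complex.I * (S.lam n : ℂ) * S.v1 n x - S.f1 n x = S.v2 n x := by
      linear_combination e1
    have e3' : Complex.I * (S.lam n : ℂ) * S.v3 n x - S.f3 n x = S.v4 n x := by
      linear_combination e3
    have e5' : Complex.I * (S.lam n : ℂ) * S.v5 n x - S.f5 n x = S.v6 n x := by
      linear_combination e5
    simp only [A, D, bxMk, bxE_eq hx2, bxP_eq hx', e1', e3', e5', bx_nsq]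
    linear_combination (‖S.v2 n x‖ ^ 2 + ‖S.v6 n x‖ ^ 2) * h1 + ‖S.v4 n x‖ ^ 2 * h2
  have iB : ∀ n, (∫ x in (0:ℝ)..L, B n x) = s ^ 2 * ∫ x in (0 : ℝ)..L,
      (k₁ * ‖deriv (S.f1 n) x + S.f3 n x + (l : ℂ) * S.f5 n x‖ ^ 2 + ρ₁ * ‖S.f2 n x‖ ^ 2
        + k₂ * ‖deriv (S.f3 n) x‖ ^ 2 + ρ₂ * ‖S.f4 n x‖ ^ 2
        + k₁ * ‖deriv (S.f5 n) x - (l : ℂ) * S.f1 n x‖ ^ 2 + ρ₁ * ‖S.f6 n x‖ ^ 2) := by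
    intro n
    rw [← intervalIntegral.integral_const_mul]
    refine bx_int_congr hb hbL (fun x hx => ?_)
    have hx' := bx_mem hb hbL hx
    have hx2 := Ioo_subset_Icc_self hx'
    have q1 : (s : ℂ) * deriv (S.f1 n) x + (s : ℂ) * S.f3 n x + (l : ℂ) * ((s : ℂ) * S.f5 n x)
        = (s : ℂ) * (deriv (S.f1 n) x + S.f3 n x + (l : ℂ) * S.f5 n x) := by ring
    have q2 : (s : ℂ) * deriv (S.f5 n) x - (l : ℂ) * ((s : ℂ) * S.f1 n x)
        = (s : ℂ) * (deriv (S.f5 n) x - (l : ℂ) * S.f1 n x) := by ring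
    have q3 : ∀ z : ℂ, ‖(s : ℂ) ^ 2 * z‖ ^ 2 = s ^ 4 * ‖z‖ ^ 2 := by
      intro z
      rw [pow_two (s : ℂ), mul_assoc, bx_nsq, bx_nsq]
      ring
    simp only [B, D, bxMk, bxE_eq hx2, bxP_eq hx', q1, q2, q3, bx_nsq]
    linear_combination s ^ 2 * (‖S.f2 n x‖ ^ 2 + ‖S.f6 n x‖ ^ 2) * h1
      + s ^ 2 * ‖S.f4 n x‖ ^ 2 * h2
  have hA1 : ∀ n x, A n x ≤ (k₁ + k₂) * (D n).NU x := by
    intro n x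
    simp only [A, BxD.NU]
    have n1 := mul_nonneg hk2.le (sq_nonneg ‖(D n).p x + (D n).ψ x + (l : ℂ) * (D n).w x‖)
    have n2 := mul_nonneg hk2.le (sq_nonneg ‖(D n).U x‖)
    have n3 := mul_nonneg hk1.le (sq_nonneg ‖(D n).q x‖)
    have n4 := mul_nonneg hk1.le (sq_nonneg ‖(D n).V x‖)
    have n5 := mul_nonneg hk2.le (sq_nonneg ‖(D n).r x - (l : ℂ) * (D n).u x‖)
    have n6 := mul_nonneg hk2.le (sq_nonneg ‖(D n).W x‖)
    linarith
  have k11 := mul_pos hk1 hk1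
  have k22 := mul_pos hk2 hk2
  have hA2 : ∀ n x, k₁ * k₂ * (D n).NU x ≤ (k₁ + k₂) * A n x := by
    intro n x
    simp only [A, BxD.NU]
    have n1 := mul_nonneg k11.le (sq_nonneg ‖(D n).p x + (D n).ψ x + (l : ℂ) * (D n).w x‖)
    have n2 := mul_nonneg k11.le (sq_nonneg ‖(D n).U x‖)
    have n3 := mul_nonneg k22.le (sq_nonneg ‖(D n).q x‖)
    have n4 := mul_nonneg k22.le (sq_nonneg ‖(D n).V x‖)
    have n5 := mul_nonneg k11.le (sq_nonneg ‖(D n).r x - (l : ℂ) * (D n).u x‖)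
    have n6 := mul_nonneg k11.le (sq_nonneg ‖(D n).W x‖)
    linarith
  have hB2 : ∀ n x, k₁ * k₂ * (D n).NF x ≤ (k₁ + k₂) * B n x := by
    intro n x
    simp only [B, BxD.NF]
    have n1 := mul_nonneg k11.le (sq_nonneg ‖(D n).g1 x + (D n).f3 x + (l : ℂ) * (D n).f5 x‖)
    have n2 := mul_nonneg k11.le (sq_nonneg ‖(D n).f2 x‖)
    have n3 := mul_nonneg k22.le (sq_nonneg ‖(D n).g3 x‖)
    have n4 := mul_nonneg k22.le (sq_nonneg ‖(D n).f4 x‖)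
    have n5 := mul_nonneg k11.le (sq_nonneg ‖(D n).g5 x - (l : ℂ) * (D n).f1 x‖)
    have n6 := mul_nonneg k11.le (sq_nonneg ‖(D n).f6 x‖)
    linarith
  have k12 := mul_pos hk1 hk2
  have int_le : ∀ {f g : ℝ → ℝ} {a b : ℝ}, Continuous f → Continuous g →
      (∀ x, a * f x ≤ b * g x) → a * (∫ x in (0:ℝ)..L, f x) ≤ b * ∫ x in (0:ℝ)..L, g x := by
    intro f g a b hf hg h
    rw [← intervalIntegral.integral_const_mul, ← intervalIntegral.integral_const_mul]
    exact intervalIntegral.integral_mono_on hL.le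
      (Continuous.intervalIntegrable (by fun_prop) _ _)
      (Continuous.intervalIntegrable (by fun_prop) _ _) (fun x _ => h x)
  have hN : ∀ n, (∫ t in (0:ℝ)..L, (D n).NU t) ≤ (k₁ + k₂) / (k₁ * k₂) := by
    intro n
    have := int_le (D n).cNU (cA n) (hA2 n)
    rw [iA n] at this
    rw [le_div_iff₀ k12]
    linarith
  have hN' : ∀ n, 1 ≤ (k₁ + k₂) * ∫ t in (0:ℝ)..L, (D n).NU t := by
    intro n
    have := int_le (a := 1) (cA n) (D n).cNU (fun x => by rw [one_mul]; exact hA1 n x)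
    rw [iA n] at this
    linarith
  have hF : Tendsto (fun n => ∫ t in (0:ℝ)..L, (D n).NF t) atTop (nhds 0) := by
    have lim := S.normF.const_mul ((k₁ + k₂) / (k₁ * k₂) * s ^ 2)
    rw [mul_zero] at lim
    refine squeeze_zero (fun n => intervalIntegral.integral_nonneg hL.le
      fun x _ => (D n).NF_nonneg x) (fun n => ?_) lim
    have := int_le (D n).cNF (cB n) (hB2 n)
    rw [iB n] at this
    rw [mul_assoc, div_mul_eq_mul_div, le_div_iff₀ k12]
    linarith
  have hlam : Tendsto (fun n => |(D n).lam|) atTop atTop := by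
    have := S.lam_tendsto.const_mul_atTop hs
    refine this.congr (fun n => ?_)
    change s * |S.lam n| = |s * S.lam n|
    rw [abs_mul, abs_of_pos hs]
  have fin := (bx_concl hl (div_pos hk1 hk2) (div_pos ha (mul_pos hk1 hs)) hb hbL D hlam hN
    hF).const_mul (k₁ + k₂)
  rw [mul_zero] at fin
  have := ge_of_tendsto' fin hN'
  linarith

end BxConv

/-- Frequency-domain criterion for exponential stability (equal wave speeds): no resolvent sequence with ℓ = 0 exists. -/
theorem bresse_exponential_stability_criterion (ρ₁ ρ₂ k₁ k₂ k₃ l L β a₀ : ℝ)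
    (hrho1 : 0 < ρ₁) (hrho2 : 0 < ρ₂) (hk1 : 0 < k₁) (hk2 : 0 < k₂) (hk3 : 0 < k₃)
    (hl : 0 < l) (hL : 0 < L) (ha0 : 0 < a₀) (hbeta : 0 < β) (hbetaL : β < L)
    (hspeed : k₁ / ρ₁ = k₂ / ρ₂) (hk : k₁ = k₃) :
    IsEmpty (BresseSetting ρ₁ ρ₂ k₁ k₂ k₃ l L β a₀ 0) := by
  subst hk
  refine ⟨fun S => ?_⟩
  have hm : 0 < ρ₁ / k₁ := div_pos hrho1 hk1
  have e : Real.sqrt (ρ₁ / k₁) ^ 2 = ρ₁ / k₁ := Real.sq_sqrt hm.le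
  refine bx_final S (Real.sqrt_pos.2 hm) ?_ ?_ hk1 hk2 hl ha0 hbeta hbetaL
  · rw [e, div_mul_cancel₀ _ hk1.ne']
  · rw [e]
    rw [div_eq_div_iff hrho1.ne' hrho2.ne'] at hspeed
    rw [div_mul_eq_mul_div, div_eq_iff hk1.ne']
    linarith
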